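/- arXiv:1604.06878 — 2 statements merged into one kernel-verified Lean document; each statement's English description precedes it below -/
import Mathlib

section
/- Let R' be the 34×34 circulant matrix over F_2 whose first row is (1,1,0,1,0,0,0,1,0,1,1,1,0,1,0,0,1,0,1,0,1,1,1,1,0,0,0,0,0,0,0,0,0,0), let B be the 35×35 matrix with first row (1,1,...,1), first column (1,1,...,1)^T, and remaining 34×34 block R', and let C be the row space of the 35×70 matrix (I_35 | B). Then C is an even [70,35] code with minimum weight 14 which is not self-dual, and it has exactly 12172 codewords of weight 14, 147390 codewords of weight 16, and 1352811 codewords of weight 18. -/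
/-- The (Hamming) weight of a vector over `ZMod 2`. -/
def wt {ι : Type*} [Fintype ι] (x : ι → ZMod 2) : ℕ :=
  (Finset.univ.filter fun i => x i ≠ 0).card

/-- The dual code of a binary linear code. -/
def dualCode {ι : Type*} [Fintype ι] (C : Submodule (ZMod 2) (ι → ZMod 2)) :
    Submodule (ZMod 2) (ι → ZMod 2) where
  carrier := {x | ∀ c ∈ C, ∑ i, x i * c i = 0}
  zero_mem' := by intro c _; simp
  add_mem' := by
    intro a b ha hb c hc
    simp only [Set.mem_setOf_eq] at ha hb ⊢
    simp [Pi.add_apply, add_mul, Finset.sum_add_distrib, ha c hc, hb c hc]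
  smul_mem' := by
    intro r a ha c hc
    simp only [Set.mem_setOf_eq] at ha ⊢
    simp [Pi.smul_apply, smul_eq_mul, mul_assoc, ← Finset.mul_sum, ha c hc]

/-- A binary linear code is self-dual if it equals its dual. -/
def IsSelfDual {ι : Type*} [Fintype ι] (C : Submodule (ZMod 2) (ι → ZMod 2)) : Prop :=
  C = dualCode C

/-- A binary code is even if every codeword has even weight. -/
def IsEvenCode {ι : Type*} [Fintype ι] (C : Submodule (ZMod 2) (ι → ZMod 2)) : Prop :=
  ∀ c ∈ C, 2 ∣ wt c

/-- `C` has minimum weight `d`: some nonzero codeword has weight `d` and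
no nonzero codeword has smaller weight. -/
def HasMinWt {ι : Type*} [Fintype ι] (C : Submodule (ZMod 2) (ι → ZMod 2)) (d : ℕ) : Prop :=
  (∃ c ∈ C, c ≠ 0 ∧ wt c = d) ∧ ∀ c ∈ C, c ≠ 0 → d ≤ wt c

/-- `Awt C i` is the number `A_i(C)` of codewords of `C` of weight `i`. -/
noncomputable def Awt {ι : Type*} [Fintype ι]
    (C : Submodule (ZMod 2) (ι → ZMod 2)) (i : ℕ) : ℕ :=
  Set.ncard {c ∈ (C : Set (ι → ZMod 2)) | wt c = i}

/-- `C` performs better than `C'`: the weight distribution of `C` is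
lexicographically smaller than that of `C'`. -/
def LexSmaller {ι : Type*} [Fintype ι]
    (C C' : Submodule (ZMod 2) (ι → ZMod 2)) : Prop :=
  ∃ s : ℕ, (∀ i < s, Awt C i = Awt C' i) ∧ Awt C s < Awt C' s

/-- A circulant matrix: each row is the cyclic shift (by one position) of the previous one,
equivalently the matrix is invariant under simultaneously cyclically shifting rows and
columns. -/
def IsCirculant {n : ℕ} (R : Matrix (Fin n) (Fin n) (ZMod 2)) : Prop :=
  ∀ i j k : Fin n, R (i + k) (j + k) = R i j

/-- The generator matrix `(I_n | R)`. -/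
def genMat {n : ℕ} (R : Matrix (Fin n) (Fin n) (ZMod 2)) :
    Matrix (Fin n) (Fin n ⊕ Fin n) (ZMod 2) :=
  Matrix.of fun i => Sum.elim (fun j => if i = j then (1 : ZMod 2) else 0) (R i)

/-- The row space (span of the rows) of a matrix over `ZMod 2`. -/
def rowSpan {ι κ : Type*} (M : Matrix ι κ (ZMod 2)) : Submodule (ZMod 2) (κ → ZMod 2) :=
  Submodule.span (ZMod 2) (Set.range M)

/-- The bordered matrix `B` with `B 0 0 = α`, the rest of the first row and first
column all ones, and remaining block the matrix `R'`. -/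
def borderMat {m : ℕ} (α : ZMod 2) (R' : Matrix (Fin m) (Fin m) (ZMod 2)) :
    Matrix (Fin (m + 1)) (Fin (m + 1)) (ZMod 2) :=
  Matrix.of fun i j =>
    if hi : i = 0 then (if j = 0 then α else 1)
    else if hj : j = 0 then 1
    else R' (i.pred hi) (j.pred hj)

/-- `C` is a pure double circulant code of length `2n`. -/
def IsPureDC {n : ℕ} (C : Submodule (ZMod 2) (Fin n ⊕ Fin n → ZMod 2)) : Prop :=
  ∃ R : Matrix (Fin n) (Fin n) (ZMod 2), IsCirculant R ∧ C = rowSpan (genMat R)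

/-- `C` is a bordered double circulant code of length `2(m+1)`. -/
def IsBorderedDC {m : ℕ} (C : Submodule (ZMod 2) (Fin (m + 1) ⊕ Fin (m + 1) → ZMod 2)) : Prop :=
  ∃ (α : ZMod 2) (R' : Matrix (Fin m) (Fin m) (ZMod 2)),
    IsCirculant R' ∧ C = rowSpan (genMat (borderMat α R'))

/-- `C` is a double circulant code: pure or bordered. -/
def IsDC {m : ℕ} (C : Submodule (ZMod 2) (Fin (m + 1) ⊕ Fin (m + 1) → ZMod 2)) : Prop :=
  IsPureDC C ∨ IsBorderedDC C

/-- The dual of a set of vectors. -/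
def dualSet {ι : Type*} [Fintype ι] (X : Set (ι → ZMod 2)) : Set (ι → ZMod 2) :=
  {x | ∀ c ∈ X, ∑ i, x i * c i = 0}

/-- The shadow `S = C_0^⊥ \ C` of `C`, where `C_0` is the doubly even subcode. -/
def shadowSet {ι : Type*} [Fintype ι] (C : Submodule (ZMod 2) (ι → ZMod 2)) :
    Set (ι → ZMod 2) :=
  dualSet {c ∈ (C : Set (ι → ZMod 2)) | 4 ∣ wt c} \ (C : Set (ι → ZMod 2))

/-- `subsetCount n k` is the number of `k`-element subsets of an `n`-element set. -/
def subsetCount : ℕ → ℕ → ℕ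
  | 0, k => bif k == 0 then 1 else 0
  | n + 1, k => Nat.rec 1 (fun k' _ => subsetCount n k + subsetCount n k') k

/-- The bitwise complement of `x` with respect to the mask `m` if `b` is true, else `x`. -/
def complIf (b : Bool) (m x : ℕ) : ℕ := bif b then m ^^^ x else x

/-- The bits at position `c` of all sums of `k` of the rows, in the order of `comb`. -/
def plane (c : ℕ) : List ℕ → ℕ → ℕ
  | [], _ => 0
  | r :: rs, k => Nat.rec 0 (fun k' _ => plane c rs k |||
      (complIf (r.testBit c) (2 ^ subsetCount rs.length k' - 1) (plane c rs k')) <<<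
        subsetCount rs.length k) k

/-- One layer of bitwise full adders: adds all planes of the list to the sum plane `a`, collecting
the carries, and passes the resulting sum and carries on. -/
def csa {α : Type} : List ℕ → ℕ → List ℕ → (ℕ → List ℕ → α) → α
  | [], a, cs, f => f a cs
  | [b], a, cs, f => f (a ^^^ b) ((a &&& b) :: cs)
  | b :: c :: l, a, cs, f => csa l (a ^^^ b ^^^ c) (((a &&& b) ||| ((a ^^^ b) &&& c)) :: cs) f

/-- The planes of the binary digits of the bitwise sums of a list of planes. -/
def digits : ℕ → List ℕ → List ℕ
  | _, [] => []
  | 0, _ => []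
  | f + 1, a :: l => csa l a [] fun s cs => s :: digits f cs

/-- The plane marking the positions where the binary digits have value `t`. -/
def ind (m : ℕ) : List ℕ → ℕ → ℕ
  | [], t => bif t == 0 then m else 0
  | d :: ds, t => ind m ds (t / 2) &&& complIf (t % 2 == 0) m d

/-- Adds adjacent digits of `x` in base `2 ^ s`, for `n` pairs of digits. -/
def fold (s n x : ℕ) : ℕ :=
  (x &&& (2 ^ (2 * s * n) - 1) / (2 ^ s + 1)) + ((x >>> s) &&& (2 ^ (2 * s * n) - 1) / (2 ^ s + 1))

/-- The number of ones among the `n` lowest bits of `x`. -/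
def popc (n x : ℕ) : ℕ :=
  fold 16 (n / 32 + 1) (fold 8 (2 * (n / 32 + 1)) (fold 4 (4 * (n / 32 + 1))
    (fold 2 (8 * (n / 32 + 1)) (fold 1 (16 * (n / 32 + 1)) x)))) % (2 ^ 32 - 1)

/-- Bit-sliced computation of the numbers `hits lo cols k v t` for `t` in the list `qs`. -/
def leaf (lo cols qs : List ℕ) (k v : ℕ) : List ℕ :=
  (fun ds => qs.map fun t => popc (subsetCount lo.length k)
     (ind (2 ^ subsetCount lo.length k - 1) ds t))
   (digits 6 (cols.map fun c =>
     complIf (v.testBit c) (2 ^ subsetCount lo.length k - 1) (plane c lo k)))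

/-- Computation of the numbers `hits (hi ++ lo) cols k v t` for `t` in the list `qs`, branching on
the rows in `hi` and bit-sliced on the rows in `lo`. -/
def count (lo cols qs : List ℕ) : List ℕ → ℕ → ℕ → List ℕ
  | [], k, v => leaf lo cols qs k v
  | r :: rs, k, v => Nat.rec (count lo cols qs rs k v) (fun k' _ =>
     List.zipWith (· + ·) (count lo cols qs rs k v) (count lo cols qs rs k' (v ^^^ r))) k

/-- All sums `v + (sum of k of the rows)`, vectors being encoded by the bits of natural numbers. -/
def comb : List ℕ → ℕ → ℕ → List ℕ
  | [], 0, v => [v]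
  | [], _ + 1, _ => []
  | _ :: rs, 0, v => comb rs 0 v
  | r :: rs, k + 1, v => comb rs (k + 1) v ++ comb rs k (v ^^^ r)

/-- The weight of `u` on the given columns. -/
def val (cols : List ℕ) (u : ℕ) : ℕ := (cols.map fun c => (u.testBit c).toNat).sum

/-- The number of sums `v + (sum of k of the rows)` of weight `t` on the given columns. -/
def hits (rows cols : List ℕ) (k v t : ℕ) : ℕ :=
  (comb rows k v).countP fun u => val cols u == t

theorem comb_xor (rs : List ℕ) (k v u : ℕ) :
    comb rs k (v ^^^ u) = (comb rs k u).map (v ^^^ ·) := by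
  induction rs generalizing k u with
  | nil => cases k <;> simp [comb]
  | cons r rs ih => cases k <;> simp [comb, ih, Nat.xor_assoc]

theorem comb_eq_map (rs : List ℕ) (k v : ℕ) : comb rs k v = (comb rs k 0).map (v ^^^ ·) := by
  simpa using comb_xor rs k v 0

theorem length_comb (rs : List ℕ) (k v : ℕ) :
    (comb rs k v).length = subsetCount rs.length k := by
  induction rs generalizing k v with
  | nil => cases k <;> simp [comb, subsetCount]
  | cons r rs ih =>
    cases k with
    | zero =>
      have := ih 0 v
      simp only [comb, this, List.length_cons, subsetCount]
      clear ih this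
      induction rs.length with
      | zero => rfl
      | succ n _ => rfl
    | succ k => simp [comb, ih, subsetCount]

theorem subsetCount_le (n k : ℕ) : subsetCount n k ≤ 2 ^ n := by
  induction n generalizing k with
  | zero => cases k <;> simp [subsetCount]
  | succ n ih =>
    cases k with
    | zero => exact Nat.one_le_two_pow
    | succ k =>
      have h1 := ih (k + 1)
      have h2 := ih k
      simp only [subsetCount, pow_succ]
      omega

theorem testBit_complIf (b : Bool) (n x j : ℕ) :
    (complIf b (2 ^ n - 1) x).testBit j = (x.testBit j ^^ (b && decide (j < n))) := by
  cases b <;> simp [complIf, Bool.xor_comm]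

theorem testBit_plane (c : ℕ) (rs : List ℕ) (k j : ℕ) :
    (plane c rs k).testBit j = (comb rs k 0)[j]?.any (·.testBit c) := by
  induction rs generalizing k j with
  | nil =>
    cases k with
    | zero => cases j <;> simp [plane, comb]
    | succ k => simp [plane, comb]
  | cons r rs ih =>
    cases k with
    | zero =>
      have h : ∀ rs : List ℕ, comb rs 0 0 = [0] := fun rs => by
        induction rs with
        | nil => rfl
        | cons r rs ih => simpa [comb] using ih
      cases j <;> simp [plane, h]
    | succ k =>
      simp only [plane, comb, Nat.testBit_or, Nat.testBit_shiftLeft, testBit_complIf, ih]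
      rw [comb_eq_map rs k (0 ^^^ r), List.getElem?_append, length_comb]
      have hl := length_comb rs (k + 1) 0
      have hl' := length_comb rs k 0
      by_cases hj : j < subsetCount rs.length (k + 1)
      · simp [hj]
      · rw [if_neg hj, List.getElem?_eq_none (by omega)]
        by_cases hjk : j - subsetCount rs.length (k + 1) < subsetCount rs.length k
        · rw [← hl'] at hjk
          simp only [List.getElem?_map, List.getElem?_eq_getElem hjk]
          simp [Nat.testBit_xor, hl' ▸ hjk, not_lt.mp hj, Bool.xor_comm]
        · rw [List.getElem?_map, List.getElem?_eq_none (l := comb rs k 0) (by omega)]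
          simp [hjk]

/-- The number whose binary digits are the `j`-th bits of the planes in the list. -/
def digitVal (j : ℕ) : List ℕ → ℕ
  | [] => 0
  | d :: ds => (d.testBit j).toNat + 2 * digitVal j ds

/-- The number of members of the list whose `j`-th bit is set. -/
def bitSum (j : ℕ) (l : List ℕ) : ℕ := (l.map fun x => (x.testBit j).toNat).sum

theorem csa_spec {α : Type} (l : List ℕ) (a : ℕ) (cs : List ℕ) (f : ℕ → List ℕ → α) :
    ∃ s cs', csa l a cs f = f s cs' ∧ cs'.length = cs.length + (l.length + 1) / 2 ∧
      ∀ j, (s.testBit j).toNat + 2 * bitSum j cs' =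
        (a.testBit j).toNat + bitSum j l + 2 * bitSum j cs := by
  induction l, a, cs, f using csa.induct with
  | case1 a cs f => exact ⟨a, cs, rfl, by simp, fun j => by simp [bitSum]⟩
  | case2 b a cs f =>
    refine ⟨_, _, rfl, by simp, fun j => ?_⟩
    simp only [bitSum, List.map_cons, List.sum_cons, Nat.testBit_xor, Nat.testBit_and,
      List.map_nil, List.sum_nil]
    cases a.testBit j <;> cases b.testBit j <;> simp <;> omega
  | case3 b c l a cs f ih =>
    obtain ⟨s, cs', h1, h2, h3⟩ := ih
    refine ⟨s, cs', h1, by simp at h2 ⊢; omega, fun j => ?_⟩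
    rw [h3]
    simp only [bitSum, List.map_cons, List.sum_cons, Nat.testBit_xor, Nat.testBit_and,
      Nat.testBit_or]
    cases a.testBit j <;> cases b.testBit j <;> cases c.testBit j <;> simp <;> omega

theorem digitVal_digits (n : ℕ) (l : List ℕ) (hl : l.length < 2 ^ n) (j : ℕ) :
    digitVal j (digits n l) = bitSum j l := by
  induction n generalizing l with
  | zero =>
    obtain rfl : l = [] := by simpa using hl
    simp [digits, digitVal, bitSum]
  | succ n ih =>
    cases l with
    | nil => simp [digits, digitVal, bitSum]
    | cons a l =>
      obtain ⟨s, cs, h1, h2, h3⟩ := csa_spec l a [] fun s cs => s :: digits n cs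
      simp only [List.length_cons, List.length_nil, pow_succ] at hl h2
      rw [digits, h1, digitVal, ih _ (by omega), h3]
      simp [bitSum]

theorem testBit_ind (n : ℕ) (ds : List ℕ) (t j : ℕ) :
    (ind (2 ^ n - 1) ds t).testBit j = (decide (j < n) && digitVal j ds == t) := by
  induction ds generalizing t with
  | nil => cases t <;> simp [ind, digitVal]
  | cons d ds ih =>
    simp only [ind, Nat.testBit_and, ih, testBit_complIf, digitVal]
    by_cases hj : j < n
    · rw [Bool.eq_iff_iff]
      rcases Nat.mod_two_eq_zero_or_one t with ht | ht <;> cases d.testBit j <;>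
        simp [hj, ht] <;> omega
    · simp [hj]

theorem and_split (k a b c d : ℕ) (hb : b < 2 ^ k) (hd : d < 2 ^ k) :
    (b + 2 ^ k * a) &&& (d + 2 ^ k * c) = (b &&& d) + 2 ^ k * (a &&& c) := by
  rw [add_comm b, add_comm d, add_comm (b &&& d)]
  refine Nat.eq_of_testBit_eq fun i => ?_
  rw [Nat.testBit_and, Nat.testBit_two_pow_mul_add _ hb, Nat.testBit_two_pow_mul_add _ hd,
    Nat.testBit_two_pow_mul_add _ (Nat.and_lt_two_pow _ hd)]
  split <;> simp

/-- The sum of the `n` lowest digits of `x` in base `2 ^ s`. -/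
def digitSum (s : ℕ) : ℕ → ℕ → ℕ
  | 0, _ => 0
  | n + 1, x => x % 2 ^ s + digitSum s n (x >>> s)

theorem mask_succ (s n : ℕ) :
    (2 ^ (2 * s * (n + 1)) - 1) / (2 ^ s + 1) =
      (2 ^ s - 1) + 2 ^ (2 * s) * ((2 ^ (2 * s * n) - 1) / (2 ^ s + 1)) := by
  obtain ⟨p, hp⟩ : ∃ p, 2 ^ s = p + 1 := ⟨2 ^ s - 1, by have := Nat.one_le_two_pow (n := s); omega⟩
  have key : ∀ n, ∃ m, 2 ^ (2 * s * n) - 1 = (2 ^ s + 1) * m := fun n => by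
    have h : 2 ^ s + 1 ∣ (2 ^ (2 * s)) ^ n - 1 ^ n := by
      refine dvd_trans ⟨p, ?_⟩ (Nat.sub_dvd_pow_sub_pow (2 ^ (2 * s)) 1 n)
      rw [mul_comm 2 s, pow_mul, hp]
      exact Nat.sub_eq_of_eq_add (by ring)
    rw [pow_mul]
    simpa [dvd_def] using h
  obtain ⟨m, hm⟩ := key n
  have h1 : 2 ^ (2 * s * n) = (2 ^ s + 1) * m + 1 := by
    have := Nat.one_le_two_pow (n := 2 * s * n); omega
  have h2 : 2 ^ (2 * s * (n + 1)) - 1 = (2 ^ s + 1) * ((2 ^ s - 1) + 2 ^ (2 * s) * m) := by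
    rw [mul_add, pow_add, h1, mul_one, mul_comm 2 s, pow_mul, hp]
    exact Nat.sub_eq_of_eq_add (by simp; ring)
  rw [h2, hm, Nat.mul_div_cancel_left _ (by positivity), Nat.mul_div_cancel_left _ (by positivity)]

theorem fold_succ (s n x : ℕ) (hs : 0 < s) :
    fold s (n + 1) x =
      (x % 2 ^ s + (x >>> s) % 2 ^ s) + 2 ^ (2 * s) * fold s n (x >>> s >>> s) := by
  have hlt : 2 ^ s ≤ 2 ^ (2 * s) := Nat.pow_le_pow_right (by norm_num) (by omega)
  have hpos := Nat.one_le_two_pow (n := s)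
  have key : ∀ y m, y &&& ((2 ^ s - 1) + 2 ^ (2 * s) * m) =
      y % 2 ^ s + 2 ^ (2 * s) * ((y >>> s >>> s) &&& m) := fun y m => by
    conv_lhs => rw [← Nat.mod_add_div y (2 ^ (2 * s))]
    rw [and_split _ _ _ _ _ (Nat.mod_lt _ (by positivity)) (by omega),
      Nat.and_two_pow_sub_one_eq_mod,
      Nat.mod_mod_of_dvd _ (pow_dvd_pow _ (by omega)), ← Nat.shiftRight_add, ← two_mul,
      Nat.shiftRight_eq_div_pow]
  simp only [fold, mask_succ s n, key]
  ring

theorem fold_lt (s n x : ℕ) (hs : 0 < s) : fold s n x < 2 ^ (2 * s * n) := by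
  induction n generalizing x with
  | zero => simp [fold]
  | succ n ih =>
    rw [fold_succ s n x hs, mul_add, pow_add, mul_one]
    have h1 := Nat.mod_lt x (Nat.two_pow_pos s)
    have h2 := Nat.mod_lt (x >>> s) (Nat.two_pow_pos s)
    have h3 : 2 * 2 ^ s ≤ 2 ^ (2 * s) := by
      rw [← pow_succ']
      exact Nat.pow_le_pow_right (by norm_num) (by omega)
    have h4 := Nat.mul_le_mul_left (2 ^ (2 * s)) (Nat.succ_le_of_lt (ih (x >>> s >>> s)))
    rw [mul_comm (2 ^ (2 * s * n))]
    rw [Nat.succ_eq_add_one, mul_add] at h4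
    omega

theorem digitSum_fold (s n x : ℕ) (hs : 0 < s) :
    digitSum (2 * s) n (fold s n x) = digitSum s (2 * n) x := by
  induction n generalizing x with
  | zero => rfl
  | succ n ih =>
    have h1 := Nat.mod_lt x (Nat.two_pow_pos s)
    have h2 := Nat.mod_lt (x >>> s) (Nat.two_pow_pos s)
    have h3 : 2 * 2 ^ s ≤ 2 ^ (2 * s) := by
      rw [← pow_succ']
      exact Nat.pow_le_pow_right (by norm_num) (by omega)
    rw [fold_succ s n x hs, digitSum, mul_add, digitSum, digitSum,
      Nat.shiftRight_eq_div_pow _ (2 * s), Nat.add_mul_mod_self_left, Nat.mod_eq_of_lt (by omega),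
      Nat.add_mul_div_left _ _ (by positivity),
      Nat.div_eq_of_lt (by omega), zero_add, ih]
    ring

theorem digitSum_modEq (s n x : ℕ) (hx : x < 2 ^ (s * n)) :
    x ≡ digitSum s n x [MOD 2 ^ s - 1] := by
  induction n generalizing x with
  | zero =>
    obtain rfl : x = 0 := by simpa using hx
    rfl
  | succ n ih =>
    have h : x >>> s < 2 ^ (s * n) := by
      rw [Nat.shiftRight_eq_div_pow]
      exact Nat.div_lt_of_lt_mul (by rwa [← pow_add, add_comm, ← mul_add_one])
    have h1 : 2 ^ s ≡ 1 [MOD 2 ^ s - 1] :=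
      ((Nat.modEq_iff_dvd' Nat.one_le_two_pow).2 dvd_rfl).symm
    calc x = x % 2 ^ s + 2 ^ s * (x >>> s) := by
          rw [Nat.shiftRight_eq_div_pow, Nat.mod_add_div]
      _ ≡ x % 2 ^ s + 1 * digitSum s n (x >>> s) [MOD 2 ^ s - 1] :=
          Nat.ModEq.add_left _ (h1.mul (ih _ h))
      _ = digitSum s (n + 1) x := by rw [one_mul, digitSum]

theorem digitSum_one (n x : ℕ) :
    digitSum 1 n x = ∑ j ∈ Finset.range n, (x.testBit j).toNat := by
  induction n generalizing x with
  | zero => rfl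
  | succ n ih =>
    rw [digitSum, ih, Finset.sum_range_succ', add_comm]
    simp [Nat.testBit_shiftRight, add_comm, Nat.testBit_zero, Bool.toNat]
    rcases Nat.mod_two_eq_zero_or_one x with h | h <;> simp [h]

theorem popc_eq (n x : ℕ) (hn : n < 2 ^ 32 - 1) (hx : x < 2 ^ n) :
    popc n x = ∑ j ∈ Finset.range n, (x.testBit j).toNat := by
  have hsum : ∀ m, n ≤ m → digitSum 1 m x = ∑ j ∈ Finset.range n, (x.testBit j).toNat := by
    intro m hm
    rw [digitSum_one]
    refine (Finset.sum_subset (Finset.range_subset_range.2 hm) fun j _ hj => ?_).symm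
    rw [Nat.testBit_lt_two_pow
      (hx.trans_le (Nat.pow_le_pow_right (by norm_num) (by simpa using hj)))]
    rfl
  have hle : ∑ j ∈ Finset.range n, (x.testBit j).toNat ≤ n := by
    simpa using Finset.sum_le_card_nsmul (Finset.range n) (fun j => (x.testBit j).toNat) 1
      fun j _ => Bool.toNat_le _
  rw [popc]
  set q := n / 32 + 1 with hq
  rw [(digitSum_modEq 32 q _ (fold_lt 16 q _ (by norm_num))),
    digitSum_fold 16 q _ (by norm_num), digitSum_fold 8 (2 * q) _ (by norm_num),
    show 2 * (2 * q) = 4 * q by ring, digitSum_fold 4 (4 * q) _ (by norm_num),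
    show 2 * (4 * q) = 8 * q by ring, digitSum_fold 2 (8 * q) _ (by norm_num),
    show 2 * (8 * q) = 16 * q by ring, digitSum_fold 1 (16 * q) _ (by norm_num),
    hsum _ (by omega)]
  exact Nat.mod_eq_of_lt (by omega)

theorem countP_eq_sum {α : Type} (l : List α) (p : α → Bool) :
    l.countP p = ∑ j ∈ Finset.range l.length, (l[j]?.any p).toNat := by
  induction l with
  | nil => rfl
  | cons a l ih =>
    rw [List.countP_cons, ih, List.length_cons, Finset.sum_range_succ']
    cases h : p a <;> simp [h]

theorem leaf_eq (lo cols qs : List ℕ) (k v : ℕ) (hlo : lo.length ≤ 31) (hc : cols.length < 64) :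
    leaf lo cols qs k v = qs.map (hits lo cols k v) := by
  have hn := subsetCount_le lo.length k
  have hn' : 2 ^ lo.length ≤ 2 ^ 31 := Nat.pow_le_pow_right (by norm_num) hlo
  refine List.map_congr_left fun t _ => ?_
  rw [popc_eq _ _ (by omega)]
  · rw [hits, comb_eq_map, List.countP_map, countP_eq_sum, length_comb]
    refine Finset.sum_congr rfl fun j hj => ?_
    have hj' := Finset.mem_range.1 hj
    rw [testBit_ind, digitVal_digits _ _ (by simpa using hc)]
    rw [← length_comb lo k 0] at hj'
    rw [List.getElem?_eq_getElem hj']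
    congr 1
    simp only [Finset.mem_range.1 hj, decide_true, Bool.true_and, Option.any_some,
      Function.comp_apply, bitSum, val, List.map_map]
    congr 2
    refine List.map_congr_left fun c _ => ?_
    simp [testBit_complIf, testBit_plane, List.getElem?_eq_getElem hj', Finset.mem_range.1 hj,
      Bool.xor_comm]
  · refine Nat.lt_pow_two_of_testBit _ fun j hj => ?_
    rw [testBit_ind]
    simp [hj]

theorem count_eq (lo cols qs hi : List ℕ) (k v : ℕ) (hlo : lo.length ≤ 31)
    (hc : cols.length < 64) :
    count lo cols qs hi k v = qs.map (hits (hi ++ lo) cols k v) := by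
  induction hi generalizing k v with
  | nil => exact leaf_eq lo cols qs k v hlo hc
  | cons r hi ih =>
    cases k with
    | zero => exact ih 0 v
    | succ k =>
      simp only [count, ih, List.zipWith_map, List.zipWith_self]
      simp [hits, comb]

theorem count_cons_succ (lo cols qs hi : List ℕ) (r k v : ℕ) :
    count lo cols qs (r :: hi) (k + 1) v =
      List.zipWith (· + ·) (count lo cols qs hi (k + 1) v) (count lo cols qs hi k (v ^^^ r)) :=
  rfl

theorem testBit_of_mem_comb {rs : List ℕ} {k v u p : ℕ} (hp : ∀ r ∈ rs, r.testBit p = false)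
    (hu : u ∈ comb rs k v) : u.testBit p = v.testBit p := by
  induction rs generalizing k v with
  | nil => cases k <;> simp_all [comb]
  | cons r rs ih =>
    simp only [List.forall_mem_cons] at hp
    cases k with
    | zero => exact ih hp.2 hu
    | succ k =>
      rcases List.mem_append.1 hu with hu | hu
      · exact ih hp.2 hu
      · rw [ih hp.2 hu, Nat.testBit_xor, hp.1, Bool.xor_false]

theorem lt_of_mem_comb {rs : List ℕ} {n k v u : ℕ} (hr : ∀ r ∈ rs, r < 2 ^ n) (hv : v < 2 ^ n)
    (hu : u ∈ comb rs k v) : u < 2 ^ n := by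
  induction rs generalizing k v with
  | nil => cases k <;> simp_all [comb]
  | cons r rs ih =>
    simp only [List.forall_mem_cons] at hr
    cases k with
    | zero => exact ih hr.2 hv hu
    | succ k =>
      rcases List.mem_append.1 hu with hu | hu
      · exact ih hr.2 hv hu
      · exact ih hr.2 (Nat.xor_lt_two_pow hv hr.1) hu

theorem val_xor_mod_two (cols : List ℕ) (u v : ℕ) :
    val cols (u ^^^ v) % 2 = (val cols u + val cols v) % 2 := by
  induction cols with
  | nil => rfl
  | cons c cols ih =>
    simp only [val, List.map_cons, List.sum_cons, Nat.testBit_xor] at ih ⊢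
    cases u.testBit c <;> cases v.testBit c <;> simp <;> omega

theorem even_val_of_mem_comb {rs cols : List ℕ} {k v u : ℕ} (hr : ∀ r ∈ rs, val cols r % 2 = 0)
    (hv : val cols v % 2 = 0) (hu : u ∈ comb rs k v) : val cols u % 2 = 0 := by
  induction rs generalizing k v with
  | nil => cases k <;> simp_all [comb]
  | cons r rs ih =>
    simp only [List.forall_mem_cons] at hr
    cases k with
    | zero => exact ih hr.2 hv hu
    | succ k =>
      rcases List.mem_append.1 hu with hu | hu
      · exact ih hr.2 hv hu
      · exact ih hr.2 (by rw [val_xor_mod_two]; omega) hu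

/-- The `i`-th row is the only row having the `i`-th pivot bit. -/
def systematic : List ℕ → List ℕ → Bool
  | [], [] => true
  | p :: ps, r :: rs => r.testBit p && rs.all (fun s => !s.testBit p) &&
      ps.all (fun q => !r.testBit q) && systematic ps rs
  | _, _ => false

theorem val_pivots_of_mem_comb {ps rs : List ℕ} (h : systematic ps rs) {k v u : ℕ}
    (hv : ∀ p ∈ ps, v.testBit p = false) (hu : u ∈ comb rs k v) : val ps u = k := by
  induction ps, rs using systematic.induct generalizing k v with
  | case1 =>
    cases k <;> simp_all [comb, val]
  | case2 p ps r rs ih =>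
    simp only [systematic, Bool.and_eq_true, List.all_eq_true, Bool.not_eq_true'] at h
    obtain ⟨⟨⟨h1, h2⟩, h3⟩, h4⟩ := h
    simp only [List.forall_mem_cons] at hv
    have key : ∀ {k v}, u ∈ comb rs k v → (∀ p ∈ ps, v.testBit p = false) →
        val (p :: ps) u = (v.testBit p).toNat + k := fun hu hv => by
      rw [val, List.map_cons, List.sum_cons, testBit_of_mem_comb h2 hu, ← val, ih h4 hv hu]
    cases k with
    | zero => rw [key hu hv.2, hv.1]; rfl
    | succ k =>
      rcases List.mem_append.1 hu with hu | hu
      · rw [key hu hv.2, hv.1]; simp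
      · rw [key hu fun q hq => by rw [Nat.testBit_xor, hv.2 q hq, h3 q hq]; rfl,
          Nat.testBit_xor, hv.1, h1, add_comm]
        rfl
  | case3 => simp [systematic] at h

theorem nodup_comb {ps rs : List ℕ} (h : systematic ps rs) (k v : ℕ) : (comb rs k v).Nodup := by
  induction ps, rs using systematic.induct generalizing k v with
  | case1 => cases k <;> simp [comb]
  | case2 p ps r rs ih =>
    simp only [systematic, Bool.and_eq_true, List.all_eq_true, Bool.not_eq_true'] at h
    obtain ⟨⟨⟨h1, h2⟩, -⟩, h4⟩ := h
    cases k with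
    | zero => exact ih h4 0 v
    | succ k =>
      refine List.nodup_append'.2 ⟨ih h4 _ _, ih h4 _ _, fun u hu hu' => ?_⟩
      have := (testBit_of_mem_comb h2 hu).symm.trans (testBit_of_mem_comb h2 hu')
      simp [Nat.testBit_xor, h1] at this
  | case3 => simp [systematic] at h

theorem ncard_mem_and {l : List ℕ} (hl : l.Nodup) (p : ℕ → Bool) :
    {u | u ∈ l ∧ p u}.ncard = l.countP p := by
  have : {u | u ∈ l ∧ p u} = ((l.filter p).toFinset : Set ℕ) := by ext; simp
  rw [this, Set.ncard_coe_finset, List.toFinset_card_of_nodup (hl.filter _),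
    List.countP_eq_length_filter]

theorem finite_mem_comb (rs : List ℕ) (P : ℕ → ℕ → Bool) (n v : ℕ) :
    {u | ∃ k < n, u ∈ comb rs k v ∧ P k u}.Finite := by
  refine ((List.range n).flatMap fun k => comb rs k v).finite_toSet.subset ?_
  rintro u ⟨k, hk, hu, -⟩
  exact List.mem_flatMap.2 ⟨k, List.mem_range.2 hk, hu⟩

theorem ncard_mem_comb {ps rs : List ℕ} (h : systematic ps rs) {v : ℕ}
    (hv : ∀ p ∈ ps, v.testBit p = false) (P : ℕ → ℕ → Bool) (n : ℕ) :
    {u | ∃ k < n, u ∈ comb rs k v ∧ P k u}.ncard =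
      ∑ k ∈ Finset.range n, (comb rs k v).countP (P k) := by
  induction n with
  | zero => simp
  | succ n ih =>
    have hun : {u | ∃ k < n + 1, u ∈ comb rs k v ∧ P k u} =
        {u | ∃ k < n, u ∈ comb rs k v ∧ P k u} ∪ {u | u ∈ comb rs n v ∧ P n u} := by
      ext u
      simp only [Nat.lt_succ_iff_lt_or_eq, Set.mem_ofPred_eq, Set.mem_union, or_and_right,
        exists_or, exists_eq_left]
    rw [hun, Set.ncard_union_eq _ (finite_mem_comb rs P n v)
      ((comb rs n v).finite_toSet.subset fun u hu => hu.1), ih, ncard_mem_and (nodup_comb h n v),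
      Finset.sum_range_succ]
    refine Set.disjoint_left.2 ?_
    rintro u ⟨k, hk, hu, -⟩ ⟨hu', -⟩
    have := val_pivots_of_mem_comb h hv hu
    have := val_pivots_of_mem_comb h hv hu'
    omega

theorem countP_val_or (rs cols : List ℕ) (k v : ℕ) {s t : ℕ} (hst : s ≠ t) :
    (comb rs k v).countP (fun u => val cols u == s || val cols u == t) =
      hits rs cols k v s + hits rs cols k v t := by
  unfold hits
  induction comb rs k v with
  | nil => rfl
  | cons u l ih =>
    simp only [List.countP_cons, ih, beq_iff_eq, Bool.or_eq_true]
    split_ifs <;> omega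

/-- The vector of length 70 encoded by the 70 lowest bits of a natural number. -/
def toVec (u : ℕ) : Fin 35 ⊕ Fin 35 → ZMod 2 :=
  Sum.elim (fun i => if u.testBit i then 1 else 0) (fun i => if u.testBit (35 + i) then 1 else 0)

theorem toVec_xor (u v : ℕ) : toVec (u ^^^ v) = toVec u + toVec v := by
  have key : ∀ a b : Bool, (if (a ^^ b) then 1 else 0 : ZMod 2) =
      (if a then 1 else 0) + (if b then 1 else 0) := by decide
  ext (i | i) <;> simp only [toVec, Pi.add_apply, Sum.elim_inl, Sum.elim_inr, Nat.testBit_xor, key]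

theorem toVec_zero : toVec 0 = 0 := by
  ext (i | i) <;> simp [toVec]

theorem toVec_injOn : Set.InjOn toVec {u | u < 2 ^ 70} := by
  intro u hu v hv h
  have key : ∀ a b : Bool, (if a then 1 else 0 : ZMod 2) = (if b then 1 else 0) → a = b := by decide
  refine Nat.eq_of_testBit_eq fun i => ?_
  by_cases hi : i < 35
  · exact key _ _ (congrFun h (Sum.inl ⟨i, hi⟩))
  by_cases hi' : i < 70
  · have := key _ _ (congrFun h (Sum.inr ⟨i - 35, by omega⟩))
    rwa [show 35 + (i - 35) = i by omega] at this
  · have hle : 2 ^ 70 ≤ 2 ^ i := Nat.pow_le_pow_right (by norm_num) (by omega)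
    rw [Nat.testBit_lt_two_pow (lt_of_lt_of_le hu hle),
      Nat.testBit_lt_two_pow (lt_of_lt_of_le hv hle)]

theorem val_range (n u : ℕ) :
    val (List.range n) u = ∑ i ∈ Finset.range n, (u.testBit i).toNat := by
  induction n with
  | zero => rfl
  | succ n ih =>
    rw [Finset.sum_range_succ, ← ih, val, List.range_succ]
    simp [val]

theorem wt_toVec (u : ℕ) : wt (toVec u) = val (List.range 70) u := by
  rw [val_range, show 70 = 35 + 35 from rfl, Finset.sum_range_add, wt, Finset.card_filter,
    Fintype.sum_sum_type, Finset.sum_range, Finset.sum_range]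
  refine congrArg₂ (· + ·) (Finset.sum_congr rfl fun i _ => ?_) (Finset.sum_congr rfl fun i _ => ?_)
  · cases h : u.testBit i <;> simp [toVec, h]
  · cases h : u.testBit (35 + i) <;> simp [toVec, h]

/-- The code spanned by the given encoded rows. -/
def spanRows (rs : List ℕ) : Submodule (ZMod 2) (Fin 35 ⊕ Fin 35 → ZMod 2) :=
  Submodule.span (ZMod 2) {x | ∃ r ∈ rs, toVec r = x}

theorem mem_spanRows (rs : List ℕ) (c : Fin 35 ⊕ Fin 35 → ZMod 2) :
    c ∈ spanRows rs ↔ ∃ k, ∃ u ∈ comb rs k 0, toVec u = c := by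
  induction rs generalizing c with
  | nil =>
    simp only [spanRows, List.not_mem_nil, false_and, exists_false, Set.ofPred_false,
      Submodule.span_empty, Submodule.mem_bot]
    refine ⟨fun h => ⟨0, 0, by simp [comb], by rw [toVec_zero, h]⟩, ?_⟩
    rintro ⟨_ | k, u, hu, rfl⟩
    · rw [List.mem_singleton.1 hu, toVec_zero]
    · simp [comb] at hu
  | cons r rs ih =>
    have hset : {x | ∃ s ∈ r :: rs, toVec s = x} =
        insert (toVec r) {x | ∃ s ∈ rs, toVec s = x} := by
      ext x; simp [eq_comm]
    rw [spanRows, hset, Submodule.mem_span_insert]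
    constructor
    · rintro ⟨a, z, hz, rfl⟩
      obtain ⟨k, u, hu, rfl⟩ := (ih z).1 hz
      obtain rfl | rfl : a = 0 ∨ a = 1 := by revert a; decide
      · refine ⟨k, u, ?_, by simp⟩
        cases k with
        | zero => exact hu
        | succ k => exact List.mem_append_left _ hu
      · refine ⟨k + 1, r ^^^ u, List.mem_append_right _ ?_, by simp [toVec_xor]⟩
        rw [comb_eq_map, Nat.zero_xor]
        exact List.mem_map_of_mem hu
    · rintro ⟨_ | k, u, hu, rfl⟩
      · exact ⟨0, toVec u, (ih _).2 ⟨0, u, hu, rfl⟩, by simp⟩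
      · rcases List.mem_append.1 hu with hu | hu
        · exact ⟨0, toVec u, (ih _).2 ⟨k + 1, u, hu, rfl⟩, by simp⟩
        · rw [comb_eq_map, Nat.zero_xor, List.mem_map] at hu
          obtain ⟨u', hu', rfl⟩ := hu
          exact ⟨1, toVec u', (ih _).2 ⟨k, u', hu', rfl⟩, by simp [toVec_xor]⟩

/-- Clears the pivot bits of `u` by adding the corresponding rows. -/
def reduce : List ℕ → List ℕ → ℕ → ℕ
  | p :: ps, r :: rs, u => reduce ps rs (bif u.testBit p then u ^^^ r else u)
  | _, _, u => u

theorem toVec_mem_of_reduce {W : Submodule (ZMod 2) (Fin 35 ⊕ Fin 35 → ZMod 2)} {ps rs : List ℕ}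
    {u : ℕ} (hW : ∀ r ∈ rs, toVec r ∈ W) (h : reduce ps rs u = 0) : toVec u ∈ W := by
  induction ps, rs, u using reduce.induct with
  | case1 p ps r rs u ih =>
    simp only [List.forall_mem_cons] at hW
    have := ih hW.2 h
    cases hp : u.testBit p
    · simpa [hp] using this
    · rw [hp, cond_true, toVec_xor] at this
      exact (Submodule.add_mem_iff_left W hW.1).1 this
  | case2 ps rs u hne =>
    have hu : u = 0 := by
      rw [← h]
      unfold reduce
      split
      · exact (hne _ _ _ _ rfl rfl).elim
      · rfl
    rw [hu, toVec_zero]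
    exact W.zero_mem

theorem spanRows_le {ps rs rs' : List ℕ} (h : rs'.all fun r => reduce ps rs r == 0) :
    spanRows rs' ≤ spanRows rs := by
  refine Submodule.span_le.2 ?_
  rintro _ ⟨r, hr, rfl⟩
  exact toVec_mem_of_reduce (fun s hs => Submodule.subset_span ⟨s, hs, rfl⟩)
    (by simpa using List.all_eq_true.1 h r hr)

/-- The first rows of the generator matrix `(I | B)`. -/
def leftHigh : List ℕ :=
  [1180591620683051565057, 1104200735630819330, 2208401436901900292, 4416802839444062216,
  8833605644528386064]

/-- The remaining rows of the generator matrix `(I | B)`. -/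
def leftLow : List ℕ :=
  [17667211254697033760, 35334422475034329152, 70668844915708919936, 141337689797058101504,
  282675379559756464640, 565350759085153190912, 1130701518135946643456, 1080811415588841721856,
  981031210494631878656, 781470800306212192256, 382349979929372819456, 764699959824385900544,
  348808298965720236032, 697616597897080733696, 214641575111109902336, 429283150187860066304,
  858566300341360394240, 536540979999669223424, 1073081959964978708480, 965572299246905851904,
  750552977810760138752, 320514334938468712448, 641028669842577686528, 101465719002103808000,
  202931437969847877632, 405862875905336016896, 811725751776312295424, 442859882869573025792,
  885719765704786313216, 590847910726521061376]

/-- The first rows of a basis, modulo `kernelWord`, which is systematic on the right half. -/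
def rightHigh : List ℕ :=
  [57266230612, 590295810433332322209, 590295810511716589792, 590295810659895205473]

/-- The remaining rows of a basis, modulo `kernelWord`, which is systematic on the right half. -/
def rightLow : List ℕ :=
  [590295810920800115868, 590295811479138018969, 590295812588365491564, 590295814760439822981,
  590295819158414355112, 590295827954366499569, 590295845547341384256, 590295880730073140001,
  590295951097680988640, 590296091841489767521, 590296373320515290976, 590296936279639036257,
  590298062190017004188, 590300313959225877861, 590304817562430952808, 590313824772062328177,
  590331839188103918912, 590367867959388310237, 590439925557385071128, 590584040758749399953,
  590872271135700973436, 591448731888552218277, 592601653390990671124, 594907496394878589557,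
  599519182425030153396, 608742554445953878325, 627189298536960691656, 664082786656832814029,
  737869762952275060792, 885443715541012074449]

/-- The codeword whose right half is zero. -/
def kernelWord : ℕ := 34359738366

/-- The rows of the generator matrix `(I | B)`. -/
def leftRows : List ℕ := leftHigh ++ leftLow

/-- A basis, modulo `kernelWord`, of the code which is systematic on the right half. -/
def rightRows : List ℕ := rightHigh ++ rightLow

/-- The columns of the left half. -/
def leftCols : List ℕ := List.range 35

/-- The columns of the right half, except the last one. -/
def rightCols : List ℕ := List.range' 35 34

/-- Entry `t - k` of row `k` counts the sums of `k` of the `leftRows` with weight `t` on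
`rightCols`. -/
def leftTable : List (List ℕ) :=
  [[1, 0, 0, 0, 0, 0, 0, 0, 0, 0, 0, 0, 0, 0, 0, 0, 0, 0, 0], [0, 0, 0, 0, 0, 0, 0, 0, 0, 0, 0,
  0, 0, 14, 20, 0, 0], [0, 0, 0, 0, 0, 0, 0, 0, 0, 12, 22, 14, 20, 112, 126], [0, 0, 0, 0, 0, 0,
  0, 20, 48, 168, 308, 413, 590], [0, 0, 0, 0, 0, 230, 552, 1290, 2365, 3514, 5020], [0, 0, 0,
  144, 468, 1625, 3900, 7332, 13442], [0, 920, 2990, 7310, 17544, 36894, 67639], [1008, 3448,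
  11206, 30175, 72420], [38415, 105420, 253008], [113802]]

/-- Entry `t - k` of row `k` counts the sums of `k` of the `rightRows` with weight `t` on
`leftCols`. -/
def rightTable : List (List ℕ) :=
  [[1, 0, 0, 0, 0, 0, 0, 0, 0, 0, 0, 0, 0, 0, 0, 0, 0, 0, 0], [0, 0, 0, 0, 0, 0, 0, 0, 0, 0, 0,
  5, 0, 4, 0, 11, 1], [0, 0, 0, 0, 0, 0, 0, 0, 0, 1, 61, 7, 58, 5, 137], [0, 0, 0, 0, 0, 0, 0,
  64, 45, 369, 89, 893, 72], [0, 0, 0, 0, 0, 35, 518, 177, 2909, 585, 6555], [0, 0, 0, 571, 244,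
  3737, 1317, 15010, 4442], [0, 168, 2656, 1481, 17052, 7797, 70489], [810, 9119, 6994, 65830,
  36338], [29628, 25931, 214588]]

/-- The analogue of `rightTable` for the coset of `kernelWord`. -/
def shiftedTable : List (List ℕ) :=
  [[0, 0, 0, 0, 0, 0, 0, 0, 0, 0, 0, 0, 0, 0, 0, 0, 0, 0, 0], [0, 0, 0, 0, 0, 0, 0, 0, 0, 0, 0,
  1, 0, 2, 0, 5, 1], [0, 0, 0, 0, 0, 0, 0, 0, 0, 3, 35, 2, 38, 3, 119], [0, 0, 0, 0, 0, 0, 0, 32,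
  19, 217, 55, 567, 56], [0, 0, 0, 0, 0, 9, 202, 79, 1486, 355, 4395], [0, 0, 0, 167, 86, 1399,
  603, 7946, 2608], [0, 48, 788, 532, 6916, 3564, 36639], [198, 2701, 2400, 26550, 16680], [8787,
  9085, 85647]]

theorem count_left_nine :
    count leftLow rightCols (List.range' 9 1) leftHigh 9 0 = leftTable.getD 9 [] := by
  have h : leftHigh = 1180591620683051565057 :: 1104200735630819330 :: leftHigh.drop 2 := rfl
  have h1 : count leftLow rightCols (List.range' 9 1) (leftHigh.drop 2) 9 0 = [62510] := by
    decide +kernel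
  have h2 : count leftLow rightCols (List.range' 9 1) (leftHigh.drop 2) 8 1180591620683051565057 =
      [22096] := by decide +kernel
  have h3 : count leftLow rightCols (List.range' 9 1) (leftHigh.drop 2) 8 1104200735630819330 =
      [22380] := by decide +kernel
  have h4 : count leftLow rightCols (List.range' 9 1) (leftHigh.drop 2) 7
      (1180591620683051565057 ^^^ 1104200735630819330) = [6816] := by decide +kernel
  rw [h, count_cons_succ, count_cons_succ, count_cons_succ, Nat.zero_xor, Nat.zero_xor, h1, h2,
    h3, h4]
  decide

theorem count_left (k : ℕ) (hk : k < 10) :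
    count leftLow rightCols (List.range' k (19 - 2 * k)) leftHigh k 0 = leftTable.getD k [] := by
  obtain rfl | hk : k = 9 ∨ k < 9 := by omega
  · exact count_left_nine
  · interval_cases k <;> decide +kernel

theorem count_right (k : ℕ) (hk : k < 9) :
    count rightLow leftCols (List.range' k (19 - 2 * k)) rightHigh k 0 = rightTable.getD k [] := by
  interval_cases k <;> decide +kernel

theorem count_shifted (k : ℕ) (hk : k < 9) :
    count rightLow leftCols (List.range' k (19 - 2 * k)) rightHigh k kernelWord =
      shiftedTable.getD k [] := by
  interval_cases k <;> decide +kernel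

theorem hits_of_count {lo hi cols l : List ℕ} {k v : ℕ} (hlo : lo.length ≤ 31)
    (hc : cols.length < 64) (h : count lo cols (List.range' k (19 - 2 * k)) hi k v = l) {t : ℕ}
    (h1 : k ≤ t) (h2 : t + k ≤ 18) : hits (hi ++ lo) cols k v t = l.getD (t - k) 0 := by
  rw [count_eq _ _ _ _ _ _ hlo hc] at h
  have ht : t - k < 19 - 2 * k := by omega
  rw [← h, List.getD_eq_getElem?_getD, List.getElem?_map, List.getElem?_range' ht]
  simp [Nat.add_sub_cancel' h1]

theorem hits_left {k t : ℕ} (h1 : k ≤ t) (h2 : t + k ≤ 18) :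
    hits leftRows rightCols k 0 t = (leftTable.getD k []).getD (t - k) 0 :=
  hits_of_count (by decide) (by decide) (count_left k (by omega)) h1 h2

theorem hits_right {k t : ℕ} (h1 : k < t) (h2 : t + k ≤ 18) :
    hits rightRows leftCols k 0 t = (rightTable.getD k []).getD (t - k) 0 :=
  hits_of_count (by decide) (by decide) (count_right k (by omega)) h1.le h2

theorem hits_shifted {k t : ℕ} (h1 : k < t) (h2 : t + k ≤ 18) :
    hits rightRows leftCols k kernelWord t = (shiftedTable.getD k []).getD (t - k) 0 :=
  hits_of_count (by decide) (by decide) (count_shifted k (by omega)) h1.le h2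

theorem systematic_leftRows : systematic leftCols leftRows = true := by decide +kernel

theorem systematic_rightRows : systematic rightCols rightRows = true := by decide +kernel

theorem spanRows_leftRows : spanRows leftRows = spanRows (kernelWord :: rightRows) :=
  le_antisymm (spanRows_le (ps := 1 :: rightCols) (by decide +kernel))
    (spanRows_le (ps := leftCols) (by decide +kernel))

/-- The numbers encoding the codewords. -/
def codewords : Set ℕ := {u | ∃ k, u ∈ comb leftRows k 0}

theorem lt_of_mem_codewords {u : ℕ} (hu : u ∈ codewords) : u < 2 ^ 70 := by
  obtain ⟨k, hu⟩ := hu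
  exact lt_of_mem_comb (by decide +kernel) (by norm_num) hu

theorem even_of_mem_codewords {u : ℕ} (hu : u ∈ codewords) : val (List.range 70) u % 2 = 0 := by
  obtain ⟨k, hu⟩ := hu
  exact even_val_of_mem_comb (by decide +kernel) (by decide +kernel) hu

theorem mem_spanRows_leftRows (c : Fin 35 ⊕ Fin 35 → ZMod 2) :
    c ∈ spanRows leftRows ↔ ∃ u ∈ codewords, toVec u = c := by
  rw [mem_spanRows]
  exact ⟨fun ⟨k, u, hu, h⟩ => ⟨u, ⟨k, hu⟩, h⟩, fun ⟨u, ⟨k, hu⟩, h⟩ => ⟨k, u, hu, h⟩⟩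

theorem mem_codewords_iff (u : ℕ) : u ∈ codewords ↔
    (∃ k, u ∈ comb rightRows k 0) ∨ ∃ k, u ∈ comb rightRows k kernelWord := by
  have h1 : u ∈ codewords ↔ ∃ k, u ∈ comb (kernelWord :: rightRows) k 0 := by
    constructor
    · intro hu
      have hc := (mem_spanRows_leftRows (toVec u)).2 ⟨u, hu, rfl⟩
      rw [spanRows_leftRows, mem_spanRows] at hc
      obtain ⟨k, w, hw, h⟩ := hc
      have hlt := lt_of_mem_comb (n := 70) (by decide +kernel) (by norm_num) hw
      exact ⟨k, toVec_injOn hlt (lt_of_mem_codewords hu) h ▸ hw⟩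
    · rintro ⟨k, hu⟩
      have hc := (mem_spanRows _ (toVec u)).2 ⟨k, u, hu, rfl⟩
      rw [← spanRows_leftRows, mem_spanRows_leftRows] at hc
      obtain ⟨w, hw, h⟩ := hc
      have hlt := lt_of_mem_comb (n := 70) (by decide +kernel) (by norm_num) hu
      exact toVec_injOn (lt_of_mem_codewords hw) hlt h ▸ hw
  rw [h1]
  constructor
  · rintro ⟨_ | k, hu⟩
    · exact Or.inl ⟨0, hu⟩
    · rcases List.mem_append.1 hu with hu | hu
      · exact Or.inl ⟨_, hu⟩
      · exact Or.inr ⟨k, by rwa [Nat.zero_xor] at hu⟩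
  · rintro (⟨_ | k, hu⟩ | ⟨k, hu⟩)
    · exact ⟨0, hu⟩
    · exact ⟨k + 1, List.mem_append_left _ hu⟩
    · exact ⟨k + 1, List.mem_append_right _ (by rwa [Nat.zero_xor])⟩

theorem val_split (u : ℕ) : val (List.range 70) u =
    val leftCols u + val rightCols u + (u.testBit 69).toNat := by
  rw [show List.range 70 = leftCols ++ rightCols ++ [69] from by decide]
  simp [val, Nat.add_assoc]

theorem ncard_heavy (h : ℕ) (hh : 0 < h) :
    {u | u ∈ codewords ∧ val (List.range 70) u = 2 * h ∧ h ≤ val rightCols u}.ncard =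
      ∑ k ∈ Finset.range h, (hits leftRows rightCols k 0 (2 * h - 1 - k) +
        hits leftRows rightCols k 0 (2 * h - k)) + hits leftRows rightCols h 0 h := by
  have hv : ∀ p ∈ leftCols, Nat.testBit 0 p = false := fun p _ => Nat.zero_testBit p
  obtain ⟨P, hP, hP'⟩ : ∃ P : ℕ → ℕ → Bool, (∀ k < h, P k = fun u =>
      val rightCols u == 2 * h - 1 - k || val rightCols u == 2 * h - k) ∧
      P h = fun u => val rightCols u == h :=
    ⟨fun k u => if k < h then val rightCols u == 2 * h - 1 - k || val rightCols u == 2 * h - k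
      else val rightCols u == h, fun k hk => funext fun u => if_pos hk,
      funext fun u => if_neg (lt_irrefl h)⟩
  have key : {u | u ∈ codewords ∧ val (List.range 70) u = 2 * h ∧ h ≤ val rightCols u} =
      {u | ∃ k < h + 1, u ∈ comb leftRows k 0 ∧ P k u} := by
    ext u
    constructor
    · rintro ⟨⟨k, hk⟩, h1, h2⟩
      have hl := val_pivots_of_mem_comb systematic_leftRows hv hk
      have hb := Bool.toNat_le (u.testBit 69)
      rw [val_split, hl] at h1
      refine ⟨k, by omega, hk, ?_⟩
      obtain hkh | rfl : k < h ∨ k = h := by omega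
      · rw [hP k hkh, Bool.or_eq_true, beq_iff_eq, beq_iff_eq]
        omega
      · rw [hP', beq_iff_eq]
        omega
    · rintro ⟨k, hk', hk, h1⟩
      have hl := val_pivots_of_mem_comb systematic_leftRows hv hk
      have hb := Bool.toNat_le (u.testBit 69)
      have he := even_of_mem_codewords ⟨k, hk⟩
      refine ⟨⟨k, hk⟩, ?_⟩
      rw [val_split, hl] at he ⊢
      obtain hkh | rfl : k < h ∨ k = h := by omega
      · rw [hP k hkh, Bool.or_eq_true, beq_iff_eq, beq_iff_eq] at h1
        omega
      · rw [hP', beq_iff_eq] at h1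
        omega
  rw [key, ncard_mem_comb systematic_leftRows hv, Finset.sum_range_succ]
  refine congrArg₂ (· + ·) ?_ ?_
  · refine Finset.sum_congr rfl fun k hk => ?_
    have hk := Finset.mem_range.1 hk
    rw [← countP_val_or _ _ _ _ (show 2 * h - 1 - k ≠ 2 * h - k by omega), hP k hk]
  · rw [hP', hits]

theorem ncard_light (v h : ℕ) (hh : 0 < h) (hv : ∀ p ∈ rightCols, v.testBit p = false)
    (hc : ∀ k, ∀ u ∈ comb rightRows k v, u ∈ codewords) :
    {u | (∃ k, u ∈ comb rightRows k v) ∧ val (List.range 70) u = 2 * h ∧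
      val rightCols u < h}.ncard =
      ∑ k ∈ Finset.range h, (hits rightRows leftCols k v (2 * h - 1 - k) +
        hits rightRows leftCols k v (2 * h - k)) := by
  have key : {u | (∃ k, u ∈ comb rightRows k v) ∧ val (List.range 70) u = 2 * h ∧
      val rightCols u < h} = {u | ∃ k < h, u ∈ comb rightRows k v ∧
        (val leftCols u == 2 * h - 1 - k || val leftCols u == 2 * h - k)} := by
    ext u
    constructor
    · rintro ⟨⟨k, hk⟩, h1, h2⟩
      have hl := val_pivots_of_mem_comb systematic_rightRows hv hk
      have hb := Bool.toNat_le (u.testBit 69)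
      rw [val_split, hl] at h1
      refine ⟨k, by omega, hk, ?_⟩
      simp
      omega
    · rintro ⟨k, hk', hk, h1⟩
      have hl := val_pivots_of_mem_comb systematic_rightRows hv hk
      have hb := Bool.toNat_le (u.testBit 69)
      have he := even_of_mem_codewords (hc k u hk)
      refine ⟨⟨k, hk⟩, ?_⟩
      rw [val_split, hl] at he ⊢
      simp at h1
      omega
  rw [key, ncard_mem_comb systematic_rightRows hv fun k u =>
    val leftCols u == 2 * h - 1 - k || val leftCols u == 2 * h - k]
  refine Finset.sum_congr rfl fun k hk => ?_
  have hk := Finset.mem_range.1 hk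
  rw [← countP_val_or _ _ _ _ (show 2 * h - 1 - k ≠ 2 * h - k by omega)]

theorem Awt_spanRows_leftRows (h : ℕ) (hh : 0 < h) : Awt (spanRows leftRows) (2 * h) =
    ∑ k ∈ Finset.range h, (hits leftRows rightCols k 0 (2 * h - 1 - k) +
        hits leftRows rightCols k 0 (2 * h - k)) + hits leftRows rightCols h 0 h +
      (∑ k ∈ Finset.range h, (hits rightRows leftCols k 0 (2 * h - 1 - k) +
        hits rightRows leftCols k 0 (2 * h - k)) +
      ∑ k ∈ Finset.range h, (hits rightRows leftCols k kernelWord (2 * h - 1 - k) +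
        hits rightRows leftCols k kernelWord (2 * h - k))) := by
  have hfin : codewords.Finite := (Set.finite_lt_nat (2 ^ 70)).subset fun u => lt_of_mem_codewords
  have himage : {c ∈ (spanRows leftRows : Set (Fin 35 ⊕ Fin 35 → ZMod 2)) | wt c = 2 * h} =
      toVec '' {u | u ∈ codewords ∧ val (List.range 70) u = 2 * h} := by
    ext c
    constructor
    · rintro ⟨hc, hw⟩
      obtain ⟨u, hu, rfl⟩ := (mem_spanRows_leftRows c).1 hc
      exact ⟨u, ⟨hu, wt_toVec u ▸ hw⟩, rfl⟩
    · rintro ⟨u, ⟨hu, hw⟩, rfl⟩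
      exact ⟨(mem_spanRows_leftRows _).2 ⟨u, hu, rfl⟩, (wt_toVec u).trans hw⟩
  have hsplit : {u | u ∈ codewords ∧ val (List.range 70) u = 2 * h} =
      {u | u ∈ codewords ∧ val (List.range 70) u = 2 * h ∧ h ≤ val rightCols u} ∪
      ({u | (∃ k, u ∈ comb rightRows k 0) ∧ val (List.range 70) u = 2 * h ∧ val rightCols u < h} ∪
       {u | (∃ k, u ∈ comb rightRows k kernelWord) ∧ val (List.range 70) u = 2 * h ∧
        val rightCols u < h}) := by
    ext u
    simp only [Set.mem_union, Set.mem_ofPred_eq, mem_codewords_iff u]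
    rcases le_or_gt h (val rightCols u) with hu | hu
    · simp only [hu, hu.not_gt, and_true, and_false, or_false]
    · simp only [hu, hu.not_ge, and_true, and_false, false_or, or_and_right]
  have hsub : ∀ v, (∀ k, ∀ u ∈ comb rightRows k v, u ∈ codewords) →
      {u | (∃ k, u ∈ comb rightRows k v) ∧ val (List.range 70) u = 2 * h ∧
        val rightCols u < h} ⊆ codewords := by
    rintro v hv u ⟨⟨k, hk⟩, -⟩
    exact hv k u hk
  have h1 : ∀ k, ∀ u ∈ comb rightRows k 0, u ∈ codewords :=
    fun k u hu => (mem_codewords_iff u).2 (Or.inl ⟨k, hu⟩)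
  have h2 : ∀ k, ∀ u ∈ comb rightRows k kernelWord, u ∈ codewords :=
    fun k u hu => (mem_codewords_iff u).2 (Or.inr ⟨k, hu⟩)
  rw [Awt, himage, (toVec_injOn.mono fun u hu => lt_of_mem_codewords hu.1).ncard_image, hsplit,
    Set.ncard_union_eq ?_ (hfin.subset fun u hu => hu.1)
      ((hfin.subset (hsub 0 h1)).union (hfin.subset (hsub kernelWord h2))),
    Set.ncard_union_eq ?_ (hfin.subset (hsub 0 h1)) (hfin.subset (hsub kernelWord h2)),
    ncard_heavy h hh, ncard_light 0 h hh (by decide +kernel) h1,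
    ncard_light kernelWord h hh (by decide +kernel) h2]
  · refine Set.disjoint_left.2 ?_
    rintro u ⟨⟨k, hk⟩, -⟩ ⟨⟨l, hl⟩, -⟩
    have hz : ∀ r ∈ rightRows, r.testBit 1 = false := by decide +kernel
    have := (testBit_of_mem_comb hz hk).symm.trans (testBit_of_mem_comb hz hl)
    revert this
    decide
  · refine Set.disjoint_left.2 ?_
    rintro u ⟨-, -, hu⟩ (⟨-, -, hu'⟩ | ⟨-, -, hu'⟩) <;> omega

theorem Awt_eq_table {h : ℕ} (hh : 0 < h) (hh' : h ≤ 9) : Awt (spanRows leftRows) (2 * h) =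
    ∑ k ∈ Finset.range h, ((leftTable.getD k []).getD (2 * h - 1 - k - k) 0 +
        (leftTable.getD k []).getD (2 * h - k - k) 0) + (leftTable.getD h []).getD (h - h) 0 +
      (∑ k ∈ Finset.range h, ((rightTable.getD k []).getD (2 * h - 1 - k - k) 0 +
        (rightTable.getD k []).getD (2 * h - k - k) 0) +
      ∑ k ∈ Finset.range h, ((shiftedTable.getD k []).getD (2 * h - 1 - k - k) 0 +
        (shiftedTable.getD k []).getD (2 * h - k - k) 0)) := by
  rw [Awt_spanRows_leftRows h hh, hits_left le_rfl (by omega)]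
  refine congrArg₂ (· + ·) (congrArg (· + _) ?_) (congrArg₂ (· + ·) ?_ ?_)
  · refine Finset.sum_congr rfl fun k hk => ?_
    have := Finset.mem_range.1 hk
    rw [hits_left (by omega) (by omega), hits_left (by omega) (by omega)]
  · refine Finset.sum_congr rfl fun k hk => ?_
    have := Finset.mem_range.1 hk
    rw [hits_right (by omega) (by omega), hits_right (by omega) (by omega)]
  · refine Finset.sum_congr rfl fun k hk => ?_
    have := Finset.mem_range.1 hk
    rw [hits_shifted (by omega) (by omega), hits_shifted (by omega) (by omega)]

theorem isEvenCode_spanRows_leftRows : IsEvenCode (spanRows leftRows) := by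
  intro c hc
  obtain ⟨u, hu, rfl⟩ := (mem_spanRows_leftRows c).1 hc
  rw [wt_toVec]
  exact Nat.dvd_of_mod_eq_zero (even_of_mem_codewords hu)

theorem hasMinWt_spanRows_leftRows : HasMinWt (spanRows leftRows) 14 := by
  constructor
  · have h : Awt (spanRows leftRows) (2 * 7) ≠ 0 := by
      rw [Awt_eq_table (by norm_num) (by norm_num)]
      decide +kernel
    obtain ⟨c, hc, hw⟩ := Set.nonempty_of_ncard_ne_zero h
    refine ⟨c, hc, ?_, hw⟩
    rintro rfl
    simp [wt] at hw
  · intro c hc hne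
    obtain ⟨h, hh⟩ := isEvenCode_spanRows_leftRows c hc
    by_contra! hlt
    have hpos : 0 < h := by
      obtain ⟨i, hi⟩ := Function.ne_iff.1 hne
      have : 0 < wt c := Finset.card_pos.2 ⟨i, by simpa using hi⟩
      omega
    have hzero : ∀ h, 0 < h → h < 7 → Awt (spanRows leftRows) (2 * h) = 0 := by
      intro h h1 h2
      rw [Awt_eq_table h1 (by omega)]
      interval_cases h <;> decide +kernel
    have hemp := hzero h hpos (by omega)
    rw [Awt, Set.ncard_eq_zero (Set.toFinite _)] at hemp
    exact (Set.ext_iff.1 hemp c).1 ⟨hc, hh⟩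

theorem not_isSelfDual_spanRows_leftRows : ¬ IsSelfDual (spanRows leftRows) := by
  intro h
  have hmem : ∀ i : Fin 35, toVec leftRows[i] ∈ spanRows leftRows := fun i =>
    Submodule.subset_span ⟨_, List.getElem_mem _, rfl⟩
  have h0 := hmem 1
  rw [IsSelfDual] at h
  rw [h] at h0
  have := h0 _ (hmem 2)
  revert this
  decide +kernel

theorem finrank_rowSpan_genMat {n : ℕ} (R : Matrix (Fin n) (Fin n) (ZMod 2)) :
    Module.finrank (ZMod 2) (rowSpan (genMat R)) = n := by
  have hli : LinearIndependent (ZMod 2) (genMat R) := by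
    refine Fintype.linearIndependent_iff.2 fun g hg i => ?_
    have := congrFun hg (Sum.inl i)
    simpa [genMat, Finset.sum_apply] using this
  rw [rowSpan, finrank_span_eq_card hli, Fintype.card_fin]

theorem rowSpan_genMat_eq (R' : Matrix (Fin 34) (Fin 34) (ZMod 2)) (hR : IsCirculant R')
    (h0 : R' 0 = ![1, 1, 0, 1, 0, 0, 0, 1, 0, 1, 1, 1, 0, 1, 0, 0, 1, 0, 1, 0, 1, 1, 1, 1,
      0, 0, 0, 0, 0, 0, 0, 0, 0, 0]) :
    rowSpan (genMat (borderMat 1 R')) = spanRows leftRows := by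
  have hR' : R' = Matrix.of fun i j => R' 0 (j - i) := by
    ext i j
    simpa using hR 0 (j - i) i
  rw [h0] at hR'
  have hrow : ∀ i : Fin 35, genMat (borderMat 1 R') i = toVec leftRows[i] := by
    have hl : ∀ i j : Fin 35,
        genMat (borderMat 1 R') i (Sum.inl j) = toVec leftRows[i] (Sum.inl j) := by
      rw [hR']
      decide +kernel
    have hr : ∀ i j : Fin 35,
        genMat (borderMat 1 R') i (Sum.inr j) = toVec leftRows[i] (Sum.inr j) := by
      rw [hR']
      decide +kernel
    exact fun i => funext (Sum.rec (hl i) (hr i))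
  rw [rowSpan, spanRows]
  congr 1
  ext c
  constructor
  · rintro ⟨i, rfl⟩
    exact ⟨_, List.getElem_mem _, (hrow i).symm⟩
  · rintro ⟨r, hr, rfl⟩
    obtain ⟨i, hi, rfl⟩ := List.getElem_of_mem hr
    exact ⟨⟨i, hi⟩, hrow _⟩

/-- The bordered double circulant code `B_{70}`. -/
theorem stmt_17 (R' : Matrix (Fin 34) (Fin 34) (ZMod 2)) (hR : IsCirculant R')
    (h0 : R' 0 = ![1, 1, 0, 1, 0, 0, 0, 1, 0, 1, 1, 1, 0, 1, 0, 0, 1, 0, 1, 0, 1, 1, 1, 1,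
      0, 0, 0, 0, 0, 0, 0, 0, 0, 0]) :
    IsEvenCode (rowSpan (genMat (borderMat 1 R'))) ∧
    Module.finrank (ZMod 2) (rowSpan (genMat (borderMat 1 R'))) = 35 ∧
    HasMinWt (rowSpan (genMat (borderMat 1 R'))) 14 ∧
    ¬ IsSelfDual (rowSpan (genMat (borderMat 1 R'))) ∧
    Awt (rowSpan (genMat (borderMat 1 R'))) 14 = 12172 ∧
    Awt (rowSpan (genMat (borderMat 1 R'))) 16 = 147390 ∧
    Awt (rowSpan (genMat (borderMat 1 R'))) 18 = 1352811 := by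
  rw [rowSpan_genMat_eq R' hR h0]
  refine ⟨isEvenCode_spanRows_leftRows, rowSpan_genMat_eq R' hR h0 ▸ finrank_rowSpan_genMat _,
    hasMinWt_spanRows_leftRows, not_isSelfDual_spanRows_leftRows, ?_, ?_, ?_⟩
  · exact (Awt_eq_table (h := 7) (by norm_num) (by norm_num)).trans (by decide +kernel)
  · exact (Awt_eq_table (h := 8) (by norm_num) (by norm_num)).trans (by decide +kernel)
  · exact (Awt_eq_table (h := 9) (by norm_num) (by norm_num)).trans (by decide +kernel)
end

section
/- Let R be the 36×36 circulant matrix over F_2 whose first row is (1,0,1,1,0,1,1,0,1,1,0,1,0,0,1,1,0,1,0,0,1,1,0,1,1,1,1,1,0,0,0,1,0,0,0,0), and let C be the row space of the 36×72 matrix (I_36 | R). Then C is an even [72,36] code with minimum weight 14 which is not self-dual, and it has exactly 8064 codewords of weight 14, 127809 codewords of weight 16, and 1202464 codewords of weight 18. -/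
/-- The carry-save sum of a running plane and a list of bit planes: a plane of low bits together
with the list of carry planes. -/
def carrySave (s : ℕ) : List ℕ → ℕ × List ℕ
  | [] => (s, [])
  | [b] => (s ^^^ b, [s &&& b])
  | b :: c :: l =>
    let t := s ^^^ b
    let r := carrySave (t ^^^ c) l
    (r.1, ((s &&& b) ||| (t &&& c)) :: r.2)

/-- The binary digits (as bit planes, least significant first) of the lane-wise population count
of a list of bit planes. -/
def popPlanes : ℕ → List ℕ → List ℕ
  | 0, _ => []
  | _ + 1, [] => []
  | n + 1, a :: l =>
    let r := carrySave a l
    r.1 :: popPlanes n r.2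

/-- The plane marking the lanes whose digits spell the number `j`. -/
def eqMask (ones : ℕ) : List ℕ → ℕ → ℕ
  | [], j => bif j == 0 then ones else 0
  | p :: ps, j => (bif j % 2 == 1 then p else p ^^^ ones) &&& eqMask ones ps (j / 2)

/-- Add the upper half (from lane `h` on) of a digit list to its lower half, with carry `c`. -/
def foldHalf (h m c : ℕ) : List ℕ → List ℕ
  | [] => [c]
  | p :: ps =>
    let a := p &&& m
    let b := p >>> h
    let t := a ^^^ b
    (t ^^^ c) :: foldHalf h m ((a &&& b) ||| (t &&& c)) ps

/-- The number whose binary digits are read off in lane `t`. -/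
def laneVal (t : ℕ) : List ℕ → ℕ
  | [] => 0
  | p :: ps => (p.testBit t).toNat + 2 * laneVal t ps

/-- The sum of the lane values over the lanes `t < 2 ^ n`. -/
def laneSum : ℕ → List ℕ → ℕ
  | 0, ps => laneVal 0 ps
  | n + 1, ps => laneSum n (foldHalf (2 ^ n) (2 ^ 2 ^ n - 1) 0 ps)

/-- Bit-sliced tables: `(T, P)` stores `T` binary words, the `c`-th bits of which form the
plane `P[c]`. -/
abbrev Table := ℕ × List ℕ

/-- Concatenation of tables. -/
def Table.cat (A B : Table) : Table :=
  (A.1 + B.1, List.zipWith (fun p q => 2 ^ A.1 * q + p) A.2 B.2)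

/-- Translate all words of a table by `r`. -/
def Table.flip (r : List Bool) (A : Table) : Table :=
  (A.1, List.zipWith (fun b p => bif b then p ^^^ (2 ^ A.1 - 1) else p) r A.2)

/-- One step of Pascal's recursion for the tables of `k`-fold sums. -/
def advance (r : List Bool) : Table → List Table → List Table
  | _, [] => []
  | A, B :: l => B.cat (A.flip r) :: advance r B l

/-- The tables of sums of `k` words from a list, for `k ≤ K`. -/
def sumTables (w K : ℕ) : List (List Bool) → List Table
  | [] => (1, List.replicate w 0) :: List.replicate K (0, List.replicate w 0)
  | r :: rs => match sumTables w K rs with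
    | [] => []
    | A :: l => A :: advance r A l

/-- The number of words of weight `j` in a table. -/
def Table.countWt (fuel : ℕ) (A : Table) (j : ℕ) : ℕ :=
  laneSum (A.1.log2 + 1) [eqMask (2 ^ A.1 - 1) (popPlanes fuel A.2) j]

/-- Count sums of weight `j` of `acc`, some words of a list, and words from the tables
`tabs`, with `k` summands besides `acc`. -/
def countSums (fuel : ℕ) (tabs : List Table) (j : ℕ) : List (List Bool) → ℕ → List Bool → ℕ
  | [], k, acc => ((tabs.getD k (0, [])).flip acc).countWt fuel j
  | _ :: rs, 0, acc => countSums fuel tabs j rs 0 acc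
  | r :: rs, k + 1, acc =>
    countSums fuel tabs j rs (k + 1) acc + countSums fuel tabs j rs k (List.zipWith xor r acc)

/-- The `i`-th row of the circulant matrix whose first row has the binary digits of `f`. -/
def circRow (f : ℕ) (i : ℕ) : List Bool :=
  (List.range 36).map fun c => f.testBit ((36 - i + c) % 36)

/-- The number of sums of weight `j` of the row `0` and `k` further rows of a circulant. -/
def circCount (f m k j : ℕ) : ℕ :=
  countSums 6 (sumTables 36 k (((List.range' 1 35).drop m).map (circRow f))) j
    (((List.range' 1 35).take m).map (circRow f)) k (circRow f 0)

theorem carrySave_length (s : ℕ) (l : List ℕ) :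
    (carrySave s l).2.length = (l.length + 1) / 2 := by
  induction s, l using carrySave.induct with
  | case1 s => simp [carrySave]
  | case2 s b => simp [carrySave]
  | case3 s b c l t ih =>
    simp only [carrySave, List.length_cons]
    rw [show (carrySave (s ^^^ b ^^^ c) l).2.length = _ from ih]
    omega

theorem carrySave_sum (t s : ℕ) (l : List ℕ) :
    (s.testBit t).toNat + (l.map fun p => (p.testBit t).toNat).sum =
      ((carrySave s l).1.testBit t).toNat +
        2 * ((carrySave s l).2.map fun p => (p.testBit t).toNat).sum := by
  induction s, l using carrySave.induct with
  | case1 s => simp [carrySave]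
  | case2 s b =>
    simp only [carrySave, List.map_cons, List.map_nil, List.sum_cons, List.sum_nil,
      Nat.testBit_xor, Nat.testBit_and]
    cases s.testBit t <;> cases b.testBit t <;> rfl
  | case3 s b c l u ih =>
    simp only [show u = s ^^^ b from rfl] at ih
    simp only [carrySave, List.map_cons, List.sum_cons, Nat.testBit_xor, Nat.testBit_and,
      Nat.testBit_or] at ih ⊢
    revert ih
    cases s.testBit t <;> cases b.testBit t <;> cases c.testBit t <;> simp <;> omega

theorem laneVal_popPlanes (t n : ℕ) (l : List ℕ) (h : l.length < 2 ^ n) :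
    laneVal t (popPlanes n l) = (l.map fun p => (p.testBit t).toNat).sum := by
  induction n generalizing l with
  | zero => simp_all [popPlanes, laneVal]
  | succ n ih =>
    cases l with
    | nil => simp [popPlanes, laneVal]
    | cons a l =>
      simp only [popPlanes, laneVal, List.map_cons, List.sum_cons]
      rw [ih, carrySave_sum]
      rw [carrySave_length]
      rw [List.length_cons, pow_succ] at h
      omega

theorem testBit_eqMask {T t : ℕ} (ht : t < T) (ps : List ℕ) (j : ℕ) :
    (eqMask (2 ^ T - 1) ps j).testBit t = decide (laneVal t ps = j) := by
  induction ps generalizing j with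
  | nil =>
    by_cases hj : j = 0
    · simp [eqMask, laneVal, hj, ht]
    · simp [eqMask, laneVal, beq_eq_false_iff_ne.2 hj, Ne.symm hj]
  | cons p ps ih =>
    rcases Nat.mod_two_eq_zero_or_one j with hj | hj <;>
      cases hp : p.testBit t <;>
      simp [eqMask, laneVal, hj, ht, ih, hp, Nat.testBit_and, Nat.testBit_xor] <;> omega

theorem testBit_eqMask_of_le {T t : ℕ} (ht : T ≤ t) (ps : List ℕ) (j : ℕ) :
    (eqMask (2 ^ T - 1) ps j).testBit t = false := by
  induction ps generalizing j with
  | nil => cases hj : j == 0 <;> simp [eqMask, hj, ht]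
  | cons p ps ih => simp [eqMask, ih, Nat.testBit_and]

theorem laneVal_foldHalf {h t : ℕ} (ht : t < h) (c : ℕ) (ps : List ℕ) :
    laneVal t (foldHalf h (2 ^ h - 1) c ps) =
      (c.testBit t).toNat + laneVal t ps + laneVal (h + t) ps := by
  induction ps generalizing c with
  | nil => simp [foldHalf, laneVal]
  | cons p ps ih =>
    simp only [foldHalf, laneVal, ih]
    simp only [Nat.testBit_xor, Nat.testBit_and, Nat.testBit_or, Nat.testBit_shiftRight,
      Nat.testBit_two_pow_sub_one, ht, decide_true, Bool.and_true]
    cases c.testBit t <;> cases p.testBit t <;> cases p.testBit (h + t) <;> simp <;> omega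

theorem laneSum_eq (n : ℕ) (ps : List ℕ) :
    laneSum n ps = ∑ t ∈ Finset.range (2 ^ n), laneVal t ps := by
  induction n generalizing ps with
  | zero => simp [laneSum]
  | succ n ih =>
    rw [laneSum, ih, pow_succ, mul_two, Finset.sum_range_add, ← Finset.sum_add_distrib]
    refine Finset.sum_congr rfl fun t ht => ?_
    rw [laneVal_foldHalf (Finset.mem_range.1 ht)]
    simp

/-- The word stored in lane `t`. -/
def lane (P : List ℕ) (t : ℕ) : List Bool := P.map fun p => p.testBit t

/-- The list of words stored in a table. -/
def Table.words (A : Table) : List (List Bool) := (List.range A.1).map (lane A.2)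

/-- A well-formed table of words of length `w` storing the list `L`. -/
structure Table.Stores (w : ℕ) (A : Table) (L : List (List Bool)) : Prop where
  length_eq : A.2.length = w
  lt_pow : ∀ p ∈ A.2, p < 2 ^ A.1
  words_eq : A.words = L

theorem count_lane (P : List ℕ) (t : ℕ) :
    (lane P t).count true = (P.map fun p => (p.testBit t).toNat).sum := by
  induction P with
  | nil => rfl
  | cons p P ih =>
    simp only [lane, List.map_cons, List.count_cons, List.sum_cons] at ih ⊢
    rw [ih]
    cases p.testBit t <;> simp [add_comm]

theorem sum_range_toNat (p : ℕ → Bool) (T : ℕ) :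
    ∑ t ∈ Finset.range T, (p t).toNat = (List.range T).countP p := by
  induction T with
  | zero => rfl
  | succ T ih =>
    rw [Finset.sum_range_succ, ih, List.range_succ, List.countP_append]
    cases h : p T <;> simp [h]

theorem Table.countWt_eq {fuel : ℕ} {A : Table} (h : A.2.length < 2 ^ fuel) (j : ℕ) :
    A.countWt fuel j = A.words.countP fun l => l.count true = j := by
  rw [Table.countWt, laneSum_eq]
  have hT : A.1 ≤ 2 ^ (A.1.log2 + 1) := Nat.lt_log2_self.le
  rw [← Finset.sum_subset (Finset.range_subset_range.2 hT), Table.words, List.countP_map,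
    ← sum_range_toNat]
  · refine Finset.sum_congr rfl fun t ht => ?_
    simp [laneVal, testBit_eqMask (Finset.mem_range.1 ht), laneVal_popPlanes _ _ _ h, count_lane]
  · intro t _ ht
    simp [laneVal, testBit_eqMask_of_le (by simpa using ht)]

theorem Table.Stores.flip {w : ℕ} {A : Table} {L : List (List Bool)} (hA : A.Stores w L)
    {r : List Bool} (hr : r.length = w) :
    (A.flip r).Stores w (L.map (List.zipWith xor r)) := by
  obtain ⟨T, P⟩ := A
  obtain ⟨h1, h2, rfl⟩ := hA
  simp only [Table.flip, Table.words] at *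
  refine ⟨by simp [h1, hr], ?_, ?_⟩
  · clear h1 hr
    induction P generalizing r with
    | nil => simp
    | cons p P ih =>
      cases r with
      | nil => simp
      | cons b r =>
        simp only [List.zipWith_cons_cons, List.mem_cons, forall_eq_or_imp] at h2 ⊢
        refine ⟨?_, ih h2.2⟩
        cases b
        · exact h2.1
        · exact Nat.xor_lt_two_pow h2.1 (by have := Nat.two_pow_pos T; omega)
  · simp only [Table.words, List.map_map]
    refine List.map_congr_left fun t ht => ?_
    rw [List.mem_range] at ht
    clear h1 h2 hr
    induction P generalizing r with
    | nil => simp [lane]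
    | cons p P ih =>
      cases r with
      | nil => simp [lane]
      | cons b r =>
        have := @ih r
        simp only [lane, List.map_cons, List.zipWith_cons_cons, Function.comp] at this ⊢
        rw [this]
        cases b <;> simp [ht]

theorem Table.Stores.cat {w : ℕ} {A B : Table} {L M : List (List Bool)} (hA : A.Stores w L)
    (hB : B.Stores w M) : (A.cat B).Stores w (L ++ M) := by
  obtain ⟨T, P⟩ := A
  obtain ⟨U, Q⟩ := B
  obtain ⟨h1, h2, rfl⟩ := hA
  obtain ⟨h3, h4, rfl⟩ := hB
  simp only [Table.cat, Table.words] at *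
  refine ⟨by simp [h1, h3], ?_, ?_⟩
  · clear h1 h3
    induction P generalizing Q with
    | nil => simp
    | cons p P ih =>
      cases Q with
      | nil => simp
      | cons q Q =>
        simp only [List.zipWith_cons_cons, List.mem_cons, forall_eq_or_imp] at h2 h4 ⊢
        refine ⟨?_, ih _ h2.2 h4.2⟩
        rw [pow_add]
        nlinarith [h2.1, Nat.two_pow_pos T, Nat.mul_le_mul_left (2 ^ T) (Nat.succ_le_of_lt h4.1)]
  · have h5 : P.length = Q.length := h1.trans h3.symm
    clear h1 h3 h4
    simp only [Table.words, List.range_add, List.map_append, List.map_map]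
    congr 1
    · refine List.map_congr_left fun t ht => ?_
      rw [List.mem_range] at ht
      induction P generalizing Q with
      | nil => simp [lane]
      | cons p P ih =>
        cases Q with
        | nil => simp at h5
        | cons q Q =>
          simp only [List.mem_cons, forall_eq_or_imp, List.length_cons, Nat.add_right_cancel_iff]
            at h2 h5
          have := ih Q h2.2 h5
          simp only [lane, List.map_cons, List.zipWith_cons_cons] at this ⊢
          rw [this, Nat.testBit_two_pow_mul_add _ h2.1, if_pos ht]
    · refine List.map_congr_left fun t _ => ?_
      induction P generalizing Q with
      | nil => cases Q <;> simp [lane] at h5 ⊢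
      | cons p P ih =>
        cases Q with
        | nil => simp at h5
        | cons q Q =>
          simp only [List.mem_cons, forall_eq_or_imp, List.length_cons, Nat.add_right_cancel_iff]
            at h2 h5
          have := ih Q h2.2 h5
          simp only [lane, List.map_cons, List.zipWith_cons_cons, Function.comp] at this ⊢
          rw [this, Nat.testBit_two_pow_mul_add _ h2.1, if_neg (by omega), Nat.add_sub_cancel_left]

/-- The list of all sums of `k` members (at distinct positions) of a list of words. -/
def kSums (w : ℕ) : List (List Bool) → ℕ → List (List Bool)
  | _, 0 => [List.replicate w false]
  | [], _ + 1 => []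
  | r :: rs, k + 1 => kSums w rs (k + 1) ++ (kSums w rs k).map (List.zipWith xor r)

theorem forall₂_advance {w : ℕ} {r : List Bool} (hr : r.length = w) {rs : List (List Bool)}
    {A : Table} {l : List Table} {k n : ℕ} (hA : A.Stores w (kSums w rs k))
    (hl : List.Forall₂ (Table.Stores w) l ((List.range' (k + 1) n).map (kSums w rs))) :
    List.Forall₂ (Table.Stores w) (advance r A l)
      ((List.range' (k + 1) n).map (kSums w (r :: rs))) := by
  induction n generalizing A l k with
  | zero =>
    cases hl
    exact .nil
  | succ n ih =>
    rw [List.range'_succ, List.map_cons] at hl ⊢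
    cases hl with
    | cons hB hl => exact .cons (hB.cat (hA.flip hr)) (ih hB hl)

theorem kSums_zero (w : ℕ) (rs : List (List Bool)) :
    kSums w rs 0 = [List.replicate w false] := by
  cases rs <;> rfl

theorem forall₂_sumTables {w K : ℕ} {rs : List (List Bool)} (hrs : ∀ r ∈ rs, r.length = w) :
    List.Forall₂ (Table.Stores w) (sumTables w K rs)
      ((List.range' 0 (K + 1)).map (kSums w rs)) := by
  induction rs with
  | nil =>
    rw [List.range'_succ, List.map_cons]
    refine .cons ⟨by simp, by simp, ?_⟩ ?_
    · simp [Table.words, lane, kSums, List.range_succ]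
    · generalize 0 + 1 = s, (show 0 < 0 + 1 by simp) = hs
      clear hrs
      induction K generalizing s with
      | zero => exact .nil
      | succ K ih =>
        rw [List.range'_succ, List.map_cons]
        refine .cons ⟨by simp, by simp, ?_⟩ (ih _ s.succ_pos)
        cases s
        · omega
        · simp [Table.words, kSums]
  | cons r rs ih =>
    have ih := ih fun r hr => hrs r (List.mem_cons_of_mem _ hr)
    rw [List.range'_succ, List.map_cons] at ih ⊢
    rw [sumTables]
    rcases h : sumTables w K rs with _ | ⟨A, l⟩
    · rw [h] at ih
      cases ih
    · rw [h] at ih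
      cases ih with
      | cons hA hl =>
        refine .cons ?_ (forall₂_advance (hrs r (by simp)) hA hl)
        simpa only [kSums_zero] using hA

theorem stores_getD_sumTables {w K k : ℕ} (hk : k ≤ K) {rs : List (List Bool)}
    (hrs : ∀ r ∈ rs, r.length = w) :
    ((sumTables w K rs).getD k (0, [])).Stores w (kSums w rs k) := by
  have h := forall₂_sumTables (K := K) hrs
  have hlen := h.length_eq
  simp only [List.length_map, List.length_range'] at hlen
  have := h.get (i := k) (by omega) (by simpa using Nat.lt_succ_of_le hk)
  rw [List.getD_eq_getElem _ _ (by omega)]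
  simpa using this

theorem zipWith_xor_zipWith_xor (a b c : List Bool) :
    List.zipWith xor a (List.zipWith xor b c) = List.zipWith xor (List.zipWith xor b a) c := by
  induction a generalizing b c with
  | nil => simp
  | cons x a ih =>
    cases b <;> cases c <;> simp [ih, Bool.xor_left_comm]

theorem countSums_eq {fuel w K k : ℕ} (hw : w < 2 ^ fuel) (hk : k ≤ K) (j : ℕ)
    {rs low : List (List Bool)} (hrs : ∀ r ∈ rs, r.length = w) (hlow : ∀ r ∈ low, r.length = w)
    {acc : List Bool} (hacc : acc.length = w) :
    countSums fuel (sumTables w K low) j rs k acc =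
      ((kSums w (rs ++ low) k).map (List.zipWith xor acc)).countP fun l => l.count true = j := by
  induction rs generalizing k acc with
  | nil =>
    have h := (stores_getD_sumTables hk hlow).flip hacc
    rw [countSums, Table.countWt_eq (by rw [h.length_eq]; exact hw), h.words_eq, List.nil_append]
  | cons r rs ih =>
    have hrs' : ∀ r ∈ rs, r.length = w := fun r hr => hrs r (List.mem_cons_of_mem _ hr)
    have hr : r.length = w := hrs r (by simp)
    cases k with
    | zero => rw [countSums, ih hk hrs' hacc, kSums_zero, kSums_zero]
    | succ k =>
      rw [countSums, ih hk hrs' hacc, ih (by omega) hrs' (by simp [hr, hacc]), List.cons_append,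
        kSums, List.map_append, List.countP_append, List.map_map]
      congr 3
      funext l
      exact (zipWith_xor_zipWith_xor _ _ _).symm

/-- The circulant matrix whose first row consists of the binary digits of `f`. -/
def circ (f : ℕ) : Matrix (Fin 36) (Fin 36) (ZMod 2) :=
  Matrix.of fun i j => if f.testBit (j - i : Fin 36).val then 1 else 0

theorem isCirculant_circ (f : ℕ) : IsCirculant (circ f) := by
  intro i j k
  simp only [circ, Matrix.of_apply, add_sub_add_right_eq_sub]

/-- A binary vector as a list of truth values. -/
def toWord {n : ℕ} (v : Fin n → ZMod 2) : List Bool := (List.finRange n).map fun i => v i ≠ 0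

theorem toWord_zero {n : ℕ} : toWord (0 : Fin n → ZMod 2) = List.replicate n false := by
  simp [toWord]

theorem toWord_add {n : ℕ} (v w : Fin n → ZMod 2) :
    toWord (v + w) = List.zipWith xor (toWord v) (toWord w) := by
  rw [toWord, toWord, toWord, List.zipWith_map, List.zipWith_self]
  refine List.map_congr_left fun i _ => ?_
  have h : ∀ a b : ZMod 2, decide (a + b ≠ 0) = (decide (a ≠ 0) ^^ decide (b ≠ 0)) := by decide
  exact h (v i) (w i)

theorem count_toWord {n : ℕ} (v : Fin n → ZMod 2) : (toWord v).count true = wt v := by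
  rw [toWord, wt, List.count, List.countP_map, Finset.card_def, Finset.filter_val,
    ← Multiset.countP_eq_card_filter]
  simp only [Function.comp_def, beq_true]
  exact (Multiset.coe_countP _ (List.finRange n)).symm

theorem circRow_eq (f : ℕ) (i : Fin 36) : circRow f i = toWord ((circ f).row i) := by
  rw [circRow, toWord, ← List.map_coe_finRange_eq_range, List.map_map]
  refine List.map_congr_left fun j _ => ?_
  simp [circ, Fin.sub_def]

theorem kSums_map_toWord {n : ℕ} {ι : Type*} (g : ι → Fin n → ZMod 2) (l : List ι) (k : ℕ) :
    kSums n (l.map fun i => toWord (g i)) k =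
      (l.sublistsLen k).map fun s => toWord (s.map g).sum := by
  induction l generalizing k with
  | nil => cases k <;> simp [kSums, toWord_zero]
  | cons a l ih =>
    cases k with
    | zero => simp [kSums, toWord_zero]
    | succ k =>
      rw [List.map_cons, kSums, ih, ih, List.sublistsLen_succ_cons, List.map_append, List.map_map,
        List.map_map]
      simp [Function.comp_def, toWord_add]

theorem countP_sublistsLen {α : Type*} (s : Finset α) {l : List α} (hl : (l : Multiset α) = s.val)
    (k : ℕ) (p : Multiset α → Prop) [DecidablePred p] :
    ((l.sublistsLen k).countP fun t : List α => p (t : Multiset α)) =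
      ((s.powersetCard k).filter fun S => p S.val).card := by
  rw [Finset.card_def, Finset.filter_val, ← Multiset.countP_map Finset.val,
    Finset.map_val_val_powersetCard, ← hl, Multiset.powersetCard_coe, Multiset.coe_countP,
    List.countP_map]
  rfl

theorem circCount_eq (f m k j : ℕ) :
    circCount f m k j = (((Finset.univ.erase (0 : Fin 36)).powersetCard k).filter fun S =>
      wt ((circ f).row 0 + ∑ i ∈ S, (circ f).row i) = j).card := by
  have hlen : ∀ L : List ℕ, ∀ r ∈ L.map (circRow f), r.length = 36 := by
    intro L r hr
    obtain ⟨i, -, rfl⟩ := List.mem_map.1 hr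
    simp [circRow]
  have hl : List.range' 1 35 = ((List.finRange 35).map Fin.succ).map Fin.val := by decide
  rw [circCount, countSums_eq (by norm_num) le_rfl j (hlen _) (hlen _) (by simp [circRow]),
    ← List.map_append, List.take_append_drop, hl, List.map_map,
    show circRow f ∘ Fin.val = fun i : Fin 36 => toWord ((circ f).row i) from funext (circRow_eq f),
    kSums_map_toWord, List.map_map, List.countP_map,
    show circRow f 0 = toWord ((circ f).row 0) from circRow_eq f 0]
  have hs : (((List.finRange 35).map Fin.succ : List (Fin 36)) : Multiset (Fin 36)) =
      (Finset.univ.erase (0 : Fin 36)).val := by decide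
  refine Eq.trans (List.countP_congr fun t _ => ?_) (countP_sublistsLen _ hs k fun S =>
    wt ((circ f).row 0 + (S.map (circ f).row).sum) = j)
  simp only [Function.comp_def, ← toWord_add, count_toWord]
  rw [decide_eq_true_iff, decide_eq_true_iff, Multiset.map_coe, Multiset.sum_coe]

/-- The number of vectors `u` of weight `k` for which `u M` has weight `j`. -/
def splitCount {n : ℕ} (M : Matrix (Fin n) (Fin n) (ZMod 2)) (k j : ℕ) : ℕ :=
  (Finset.univ.filter fun u : Fin n → ZMod 2 => wt u = k ∧ wt (Matrix.vecMul u M) = j).card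

theorem card_filter_apply_ne_zero {n : ℕ} [NeZero n] (M : Matrix (Fin n) (Fin n) (ZMod 2))
    (k j : ℕ) :
    (Finset.univ.filter fun u : Fin n → ZMod 2 =>
        u 0 ≠ 0 ∧ wt u = k + 1 ∧ wt (Matrix.vecMul u M) = j).card =
      (((Finset.univ.erase (0 : Fin n)).powersetCard k).filter fun S =>
        wt (M.row 0 + ∑ i ∈ S, M.row i) = j).card := by
  have h01 : ∀ a : ZMod 2, a ≠ 0 → a = 1 := by decide
  symm
  refine Finset.card_nbij' (fun S i => if i ∈ insert 0 S then 1 else 0)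
    (fun u => (Finset.univ.filter fun i => u i ≠ 0).erase 0) ?_ ?_ ?_ ?_
  · intro S hS
    simp only [Finset.coe_filter, Finset.mem_powersetCard, Set.mem_ofPred_eq] at hS
    have h0 : (0 : Fin n) ∉ S := fun h => by simpa using hS.1.1 h
    simp only [Finset.coe_filter, Finset.mem_univ, true_and, Set.mem_ofPred_eq]
    refine ⟨by simp, ?_, ?_⟩
    · rw [wt, ← hS.1.2, ← Finset.card_insert_of_notMem h0]
      congr 1
      ext i
      simp [imp_iff_not_or, or_comm]
    · rw [← hS.2, Matrix.vecMul_eq_sum, ← Finset.sum_insert h0]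
      congr 1
      rw [← Finset.sum_subset (Finset.subset_univ (insert 0 S))]
      · exact Finset.sum_congr rfl fun i hi => by rw [if_pos hi, one_smul]; rfl
      · intro i _ hi
        rw [if_neg hi, zero_smul]
  · intro u hu
    simp only [Finset.coe_filter, Finset.mem_univ, true_and, Set.mem_ofPred_eq] at hu
    have h0 : (0 : Fin n) ∈ Finset.univ.filter fun i => u i ≠ 0 := by simpa using hu.1
    simp only [Finset.coe_filter, Finset.mem_powersetCard, Set.mem_ofPred_eq]
    refine ⟨⟨Finset.erase_subset_erase _ (Finset.subset_univ _), ?_⟩, ?_⟩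
    · rw [Finset.card_erase_of_mem h0, ← wt, hu.2.1, Nat.add_sub_cancel]
    · rw [← hu.2.2, Matrix.vecMul_eq_sum, Finset.add_sum_erase _ _ h0]
      congr 1
      rw [Finset.sum_filter]
      refine Finset.sum_congr rfl fun i _ => ?_
      split_ifs with hi
      · rw [h01 _ hi, one_smul]; rfl
      · rw [not_not.1 hi, zero_smul]
  · intro S hS
    simp only [Finset.coe_filter, Finset.mem_powersetCard, Set.mem_ofPred_eq] at hS
    have h0 : (0 : Fin n) ∉ S := fun h => by simpa using hS.1.1 h
    ext i
    simp only [Finset.mem_erase, Finset.mem_filter, Finset.mem_univ, true_and, Finset.mem_insert]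
    by_cases hi : i = 0
    · simp [hi, h0]
    · simp [hi]
  · intro u hu
    simp only [Finset.coe_filter, Finset.mem_univ, true_and, Set.mem_ofPred_eq] at hu
    ext i
    by_cases hi : u i = 0
    · have : i ≠ 0 := fun h => hu.1 (h ▸ hi)
      simp [hi, this]
    · simp [h01 _ hi, em]

theorem wt_comp_equiv {ι : Type*} [Fintype ι] (e : ι ≃ ι) (x : ι → ZMod 2) :
    wt (x ∘ e) = wt x := by
  rw [wt, wt, ← Finset.card_map e.toEmbedding]
  congr 1
  ext i
  simp [Finset.mem_map_equiv]

theorem vecMul_comp_addRight {n : ℕ} [NeZero n] {M : Matrix (Fin n) (Fin n) (ZMod 2)}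
    (hM : IsCirculant M) (c : Fin n) (u : Fin n → ZMod 2) :
    Matrix.vecMul (u ∘ Equiv.addRight c) M = Matrix.vecMul u M ∘ Equiv.addRight c := by
  ext j
  simp only [Matrix.vecMul, dotProduct, Function.comp_apply]
  rw [← Equiv.sum_comp (Equiv.addRight c) fun i => u i * M i (Equiv.addRight c j)]
  exact Finset.sum_congr rfl fun i _ => by rw [Equiv.coe_addRight, hM]

theorem mul_splitCount {n : ℕ} [NeZero n] {M : Matrix (Fin n) (Fin n) (ZMod 2)}
    (hM : IsCirculant M) (k j : ℕ) :
    k * splitCount M k j = n * (Finset.univ.filter fun u : Fin n → ZMod 2 =>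
      u 0 ≠ 0 ∧ wt u = k ∧ wt (Matrix.vecMul u M) = j).card := by
  have h1 := Finset.sum_card_bipartiteAbove_eq_sum_card_bipartiteBelow
    (fun (u : Fin n → ZMod 2) (c : Fin n) => u c ≠ 0)
    (s := Finset.univ.filter fun u : Fin n → ZMod 2 =>
      wt u = k ∧ wt (Matrix.vecMul u M) = j) (t := Finset.univ)
  rw [Finset.sum_congr rfl (g := fun _ => k), Finset.sum_const, smul_eq_mul] at h1
  · rw [splitCount, mul_comm, h1, Finset.sum_congr rfl (g := fun _ => _), Finset.sum_const,
      Finset.card_univ, Fintype.card_fin, smul_eq_mul]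
    intro c _
    rw [Finset.bipartiteBelow, Finset.filter_filter]
    refine Finset.card_nbij' (fun u => u ∘ Equiv.addRight c) (fun u => u ∘ (Equiv.addRight c).symm)
      ?_ ?_ ?_ ?_
    · intro u hu
      simp only [Finset.coe_filter, Finset.mem_univ, true_and, Set.mem_ofPred_eq] at hu ⊢
      rw [vecMul_comp_addRight hM, wt_comp_equiv, wt_comp_equiv]
      exact ⟨by simpa using hu.2, hu.1⟩
    · intro u hu
      simp only [Finset.coe_filter, Finset.mem_univ, true_and, Set.mem_ofPred_eq] at hu ⊢
      rw [Equiv.addRight_symm, vecMul_comp_addRight hM, wt_comp_equiv, wt_comp_equiv]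
      exact ⟨hu.2, by simpa using hu.1⟩
    · intro u _
      ext i
      simp
    · intro u _
      ext i
      simp
  · intro u hu
    exact (Finset.mem_filter.1 hu).2.1

theorem succ_mul_splitCount_circ {f m k j b : ℕ} (h : circCount f m k j = b) :
    (k + 1) * splitCount (circ f) (k + 1) j = 36 * b := by
  rw [mul_splitCount (isCirculant_circ f), card_filter_apply_ne_zero, ← h, circCount_eq]

theorem wt_eq_zero {ι : Type*} [Fintype ι] {x : ι → ZMod 2} : wt x = 0 ↔ x = 0 := by
  simp [wt, Finset.filter_eq_empty_iff, funext_iff]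

theorem Awt_ne_zero_iff {ι : Type*} [Fintype ι] {C : Submodule (ZMod 2) (ι → ZMod 2)} {w : ℕ} :
    Awt C w ≠ 0 ↔ ∃ c ∈ C, wt c = w := by
  rw [Awt, ← Nat.pos_iff_ne_zero, Set.ncard_pos]
  rfl

theorem splitCount_zero {n : ℕ} (M : Matrix (Fin n) (Fin n) (ZMod 2)) {j : ℕ} (hj : 0 < j) :
    splitCount M 0 j = 0 := by
  rw [splitCount, Finset.card_eq_zero, Finset.filter_eq_empty_iff]
  rintro u - ⟨hu, h⟩
  rw [wt_eq_zero.1 hu, Matrix.zero_vecMul, wt_eq_zero.2 rfl] at h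
  exact hj.ne h

theorem map_splitCount_circ {f m k : ℕ} {js bs : List ℕ} (h : js.map (circCount f m k) = bs) :
    js.map (fun j => (k + 1) * splitCount (circ f) (k + 1) j) = bs.map (36 * ·) := by
  rw [← h, List.map_map]
  exact List.map_congr_left fun j _ => succ_mul_splitCount_circ rfl

theorem wt_sumElim {ι κ : Type*} [Fintype ι] [Fintype κ] (u : ι → ZMod 2) (v : κ → ZMod 2) :
    wt (Sum.elim u v) = wt u + wt v := by
  simp only [wt, Finset.card_filter, Fintype.sum_sum_type, Sum.elim_inl, Sum.elim_inr]
  rfl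

theorem vecMul_genMat {n : ℕ} (R : Matrix (Fin n) (Fin n) (ZMod 2)) (u : Fin n → ZMod 2) :
    Matrix.vecMul u (genMat R) = Sum.elim u (Matrix.vecMul u R) := by
  ext (j | j) <;> simp [genMat, Matrix.vecMul, dotProduct]

theorem rowSpan_eq_range {ι κ : Type*} [Fintype ι] (M : Matrix ι κ (ZMod 2)) :
    rowSpan M = LinearMap.range M.vecMulLinear :=
  (_root_.range_vecMulLinear M).symm

theorem mem_rowSpan_genMat {n : ℕ} {R : Matrix (Fin n) (Fin n) (ZMod 2)}
    {c : Fin n ⊕ Fin n → ZMod 2} :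
    c ∈ rowSpan (genMat R) ↔ ∃ u, Sum.elim u (Matrix.vecMul u R) = c := by
  simp [rowSpan_eq_range, vecMul_genMat]

theorem Awt_rowSpan_genMat {n : ℕ} (R : Matrix (Fin n) (Fin n) (ZMod 2)) (w : ℕ) :
    Awt (rowSpan (genMat R)) w =
      (Finset.univ.filter fun u : Fin n → ZMod 2 => wt u + wt (Matrix.vecMul u R) = w).card := by
  have hinj : Function.Injective fun u : Fin n → ZMod 2 => Sum.elim u (Matrix.vecMul u R) :=
    fun u v h => (Sum.elim_eq_iff.1 h).1
  rw [Awt, ← Finset.card_map ⟨_, hinj⟩, ← Set.ncard_coe_finset]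
  congr 1
  ext c
  simp only [SetLike.mem_coe, mem_rowSpan_genMat, Set.mem_ofPred_eq, Finset.coe_map,
    Function.Embedding.coeFn_mk, Finset.coe_filter, Finset.mem_univ, true_and, Set.mem_image]
  constructor
  · rintro ⟨⟨u, rfl⟩, h⟩
    exact ⟨u, by rwa [wt_sumElim] at h, rfl⟩
  · rintro ⟨u, h, rfl⟩
    exact ⟨⟨u, rfl⟩, by rwa [wt_sumElim]⟩

theorem card_wt_lt_eq_sum {n : ℕ} (R : Matrix (Fin n) (Fin n) (ZMod 2)) {w t : ℕ}
    (ht : t ≤ w + 1) :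
    (Finset.univ.filter fun u : Fin n → ZMod 2 =>
        wt u + wt (Matrix.vecMul u R) = w ∧ wt u < t).card =
      ∑ k ∈ Finset.range t, splitCount R k (w - k) := by
  rw [Finset.card_eq_sum_card_fiberwise (f := wt) (t := Finset.range t)]
  · refine Finset.sum_congr rfl fun k hk => ?_
    rw [Finset.mem_range] at hk
    rw [splitCount, Finset.filter_filter]
    congr 1
    ext u
    simp only [Finset.mem_filter, Finset.mem_univ, true_and]
    omega
  · intro u hu
    simpa using (Finset.mem_filter.1 hu).2.2

/-- Codewords `(u, u R)` of weight `w` are counted according to the weight of `u` if this is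
less than `t`, and otherwise according to the weight of `u R`. -/
theorem Awt_eq_sum_splitCount {n : ℕ} {R S : Matrix (Fin n) (Fin n) (ZMod 2)} (hRS : R * S = 1)
    (w t : ℕ) (ht : t ≤ w + 1) :
    Awt (rowSpan (genMat R)) w =
      ∑ k ∈ Finset.range t, splitCount R k (w - k) +
        ∑ k ∈ Finset.range (w + 1 - t), splitCount S k (w - k) := by
  have hSR : S * R = 1 := mul_eq_one_comm.1 hRS
  rw [Awt_rowSpan_genMat, ← card_wt_lt_eq_sum R ht, ← card_wt_lt_eq_sum S (Nat.sub_le _ _),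
    ← Finset.card_filter_add_card_filter_not fun u => wt u < t, Finset.filter_filter,
    Finset.filter_filter]
  congr 1
  refine Finset.card_nbij' (fun u => Matrix.vecMul u R) (fun v => Matrix.vecMul v S) ?_ ?_ ?_ ?_
  · intro u hu
    simp only [Finset.coe_filter, Finset.mem_univ, true_and, Set.mem_ofPred_eq] at hu ⊢
    rw [Matrix.vecMul_vecMul, hRS, Matrix.vecMul_one]
    omega
  · intro u hu
    simp only [Finset.coe_filter, Finset.mem_univ, true_and, Set.mem_ofPred_eq] at hu ⊢
    rw [Matrix.vecMul_vecMul, hSR, Matrix.vecMul_one]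
    omega
  · intro u _
    simp only [Matrix.vecMul_vecMul, hRS, Matrix.vecMul_one]
  · intro u _
    simp only [Matrix.vecMul_vecMul, hSR, Matrix.vecMul_one]

theorem natCast_wt {ι : Type*} [Fintype ι] (x : ι → ZMod 2) : (wt x : ZMod 2) = ∑ i, x i := by
  have h : ∀ a : ZMod 2, (if a ≠ 0 then 1 else 0) = a := by decide
  rw [wt, Finset.card_filter, Nat.cast_sum]
  exact Finset.sum_congr rfl fun i _ => by rw [Nat.cast_ite, Nat.cast_one, Nat.cast_zero, h]

theorem isEvenCode_rowSpan {ι κ : Type*} [Fintype κ] {M : Matrix ι κ (ZMod 2)}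
    (h : ∀ i, ∑ j, M i j = 0) : IsEvenCode (rowSpan M) := by
  intro c hc
  rw [← ZMod.natCast_eq_zero_iff, natCast_wt]
  induction hc using Submodule.span_induction with
  | mem x hx =>
    obtain ⟨i, rfl⟩ := hx
    exact h i
  | zero => simp
  | add x y _ _ hx hy => simp [Finset.sum_add_distrib, hx, hy]
  | smul a x _ hx => simp [← Finset.mul_sum, hx]

theorem sum_row_eq {n : ℕ} [NeZero n] {R : Matrix (Fin n) (Fin n) (ZMod 2)} (hR : IsCirculant R)
    (i : Fin n) : ∑ j, R i j = ∑ j, R 0 j := by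
  rw [← Equiv.sum_comp (Equiv.addRight i) fun j => R i j]
  refine Finset.sum_congr rfl fun j _ => ?_
  rw [Equiv.coe_addRight, ← hR 0 j i, zero_add]

theorem IsCirculant.ext {n : ℕ} [NeZero n] {R S : Matrix (Fin n) (Fin n) (ZMod 2)}
    (hR : IsCirculant R) (hS : IsCirculant S) (h : R 0 = S 0) : R = S := by
  ext i j
  have hRS := congrFun h (j - i)
  rwa [← hR 0 (j - i) i, ← hS 0 (j - i) i, zero_add, sub_add_cancel] at hRS

theorem IsCirculant.mul {n : ℕ} [NeZero n] {R S : Matrix (Fin n) (Fin n) (ZMod 2)}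
    (hR : IsCirculant R) (hS : IsCirculant S) : IsCirculant (R * S) := by
  intro i j k
  rw [Matrix.mul_apply, Matrix.mul_apply, ← Equiv.sum_comp (Equiv.addRight k)]
  exact Finset.sum_congr rfl fun l _ => by rw [Equiv.coe_addRight, hR, hS]

theorem isCirculant_one {n : ℕ} : IsCirculant (1 : Matrix (Fin n) (Fin n) (ZMod 2)) := by
  intro i j k
  have := i.neZero
  simp [Matrix.one_apply]

/-- The binary digits of the first row of the circulant matrix defining the code `P_{72}`. -/
def genBits : ℕ := 2410859373

/-- The binary digits of the first row of the inverse of `circ genBits`. -/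
def invBits : ℕ := 3488175237

theorem circ_genBits_mul_circ_invBits : circ genBits * circ invBits = 1 := by
  refine ((isCirculant_circ _).mul (isCirculant_circ _)).ext isCirculant_one ?_
  decide +kernel

theorem circCount_genBits_zero :
    [1, 3, 5, 7, 9, 11, 13, 15, 17].map (circCount genBits 0 0) = [0, 0, 0, 0, 0, 0, 0, 0, 0] := by
  decide +kernel

theorem circCount_genBits_one :
    [0, 2, 4, 6, 8, 10, 12, 14, 16].map (circCount genBits 0 1) = [0, 0, 0, 0, 0, 0, 4, 3, 2] := by
  decide +kernel

theorem circCount_genBits_two :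
    [1, 3, 5, 7, 9, 11, 13, 15].map (circCount genBits 0 2) = [0, 0, 0, 0, 0, 15, 39, 136] := by
  decide +kernel

theorem circCount_genBits_three :
    [0, 2, 4, 6, 8, 10, 12, 14].map (circCount genBits 0 3) = [0, 0, 0, 0, 0, 32, 222, 772] := by
  decide +kernel

theorem circCount_genBits_four :
    [1, 3, 5, 7, 9, 11, 13].map (circCount genBits 0 4) = [0, 0, 0, 0, 130, 1035, 3285] := by
  decide +kernel

theorem circCount_genBits_five :
    [0, 2, 4, 6, 8, 10, 12].map (circCount genBits 0 5) = [0, 0, 0, 0, 216, 2583, 12092] := by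
  decide +kernel

theorem circCount_genBits_six :
    [1, 3, 5, 7, 9, 11].map (circCount genBits 3 6) = [0, 0, 0, 399, 4718, 28679] := by
  decide +kernel

theorem circCount_genBits_seven :
    [0, 2, 4, 6, 8, 10].map (circCount genBits 5 7) = [0, 0, 0, 360, 6330, 50088] := by
  decide +kernel

theorem circCount_genBits_eight :
    [1, 3, 5, 7, 9].map (circCount genBits 5 8) = [0, 0, 261, 6327, 62749] := by
  decide +kernel

theorem circCount_invBits_zero :
    [11, 13, 15, 17].map (circCount invBits 0 0) = [0, 0, 0, 1] := by
  decide +kernel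

theorem circCount_invBits_one :
    [10, 12, 14, 16].map (circCount invBits 0 1) = [0, 0, 6, 2] := by
  decide +kernel

theorem circCount_invBits_two :
    [11, 13, 15].map (circCount invBits 0 2) = [12, 42, 81] := by
  decide +kernel

theorem circCount_invBits_three :
    [10, 12, 14].map (circCount invBits 0 3) = [48, 298, 724] := by
  decide +kernel

theorem circCount_invBits_four :
    [11, 13].map (circCount invBits 0 4) = [900, 3430] := by
  decide +kernel

theorem circCount_invBits_five :
    [10, 12].map (circCount invBits 0 5) = [2418, 11514] := by
  decide +kernel

theorem circCount_invBits_six :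
    [11].map (circCount invBits 3 6) = [28392] := by
  decide +kernel

theorem circCount_invBits_seven :
    [10].map (circCount invBits 5 7) = [50312] := by
  decide +kernel

/-- The weight distribution up to `18`, computed from the counts `p` and `q` of codewords
`(u, v)` according to the weights of `u` and `v`, resp. of `v` and `u`. -/
theorem weights_of_splitCounts {A : ℕ → ℕ} {p q : ℕ → ℕ → ℕ}
    (hA : ∀ w t, t ≤ w + 1 → A w = ∑ k ∈ Finset.range t, p k (w - k) +
      ∑ k ∈ Finset.range (w + 1 - t), q k (w - k))
    (hp0 : ∀ j, 0 < j → p 0 j = 0) (hq0 : ∀ j, 0 < j → q 0 j = 0)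
    (hp : ∀ {m k js bs}, List.map (circCount genBits m k) js = bs →
      js.map (fun j => (k + 1) * p (k + 1) j) = bs.map (36 * ·))
    (hq : ∀ {m k js bs}, List.map (circCount invBits m k) js = bs →
      js.map (fun j => (k + 1) * q (k + 1) j) = bs.map (36 * ·)) :
    A 2 = 0 ∧ A 4 = 0 ∧ A 6 = 0 ∧ A 8 = 0 ∧ A 10 = 0 ∧ A 12 = 0 ∧
      A 14 = 8064 ∧ A 16 = 127809 ∧ A 18 = 1202464 := by
  have p1 := hp circCount_genBits_zero
  have p2 := hp circCount_genBits_one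
  have p3 := hp circCount_genBits_two
  have p4 := hp circCount_genBits_three
  have p5 := hp circCount_genBits_four
  have p6 := hp circCount_genBits_five
  have p7 := hp circCount_genBits_six
  have p8 := hp circCount_genBits_seven
  have p9 := hp circCount_genBits_eight
  have q1 := hq circCount_invBits_zero
  have q2 := hq circCount_invBits_one
  have q3 := hq circCount_invBits_two
  have q4 := hq circCount_invBits_three
  have q5 := hq circCount_invBits_four
  have q6 := hq circCount_invBits_five
  have q7 := hq circCount_invBits_six
  have q8 := hq circCount_invBits_seven
  simp only [List.map_cons, List.map_nil, List.cons.injEq, and_true, Nat.reduceAdd, Nat.reduceMul]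
    at p1 p2 p3 p4 p5 p6 p7 p8 p9 q1 q2 q3 q4 q5 q6 q7 q8
  rw [hA 2 3 (by norm_num), hA 4 5 (by norm_num), hA 6 7 (by norm_num), hA 8 9 (by norm_num),
    hA 10 10 (by norm_num), hA 12 10 (by norm_num), hA 14 10 (by norm_num),
    hA 16 10 (by norm_num), hA 18 10 (by norm_num)]
  simp only [Finset.sum_range_succ, Finset.sum_range_zero, Nat.reduceSub, Nat.reduceAdd, hp0, hq0,
    Nat.ofNat_pos]
  refine ⟨?_, ?_, ?_, ?_, ?_, ?_, ?_, ?_, ?_⟩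
  · clear hA hp hq
    omega
  · clear hA hp hq
    omega
  · clear hA hp hq
    omega
  · clear hA hp hq
    omega
  · clear hA hp hq
    omega
  · clear hA hp hq
    omega
  · clear hA hp hq
    omega
  · clear hA hp hq
    omega
  · clear hA hp hq
    omega

/-- The pure double circulant code `P_{72}`. -/
theorem stmt_18 (R : Matrix (Fin 36) (Fin 36) (ZMod 2)) (hR : IsCirculant R)
    (h0 : R 0 = ![1, 0, 1, 1, 0, 1, 1, 0, 1, 1, 0, 1, 0, 0, 1, 1, 0, 1, 0, 0, 1, 1, 0, 1,
      1, 1, 1, 1, 0, 0, 0, 1, 0, 0, 0, 0]) :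
    IsEvenCode (rowSpan (genMat R)) ∧
    Module.finrank (ZMod 2) (rowSpan (genMat R)) = 36 ∧
    HasMinWt (rowSpan (genMat R)) 14 ∧
    ¬ IsSelfDual (rowSpan (genMat R)) ∧
    Awt (rowSpan (genMat R)) 14 = 8064 ∧
    Awt (rowSpan (genMat R)) 16 = 127809 ∧
    Awt (rowSpan (genMat R)) 18 = 1202464 := by
  obtain rfl : R = circ genBits := by
    refine hR.ext (isCirculant_circ _) (h0.trans ?_)
    decide +kernel
  have heven : IsEvenCode (rowSpan (genMat (circ genBits))) := by
    refine isEvenCode_rowSpan fun i => ?_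
    rw [Fintype.sum_sum_type]
    simp only [genMat, Matrix.of_apply, Sum.elim_inl, Sum.elim_inr, Finset.sum_ite_eq,
      Finset.mem_univ, if_true]
    rw [sum_row_eq hR]
    decide +kernel
  obtain ⟨h2, h4, h6, h8, h10, h12, h14, h16, h18⟩ := weights_of_splitCounts
    (Awt_eq_sum_splitCount circ_genBits_mul_circ_invBits) (fun _ => splitCount_zero _)
    (fun _ => splitCount_zero _) map_splitCount_circ map_splitCount_circ
  refine ⟨heven, finrank_rowSpan_genMat _, ⟨?_, fun c hc hc0 => ?_⟩, fun hself => ?_, h14, h16, h18⟩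
  · obtain ⟨c, hc, hwt⟩ := Awt_ne_zero_iff.1 (h14.trans_ne (by norm_num))
    refine ⟨c, hc, ?_, hwt⟩
    rintro rfl
    rw [wt_eq_zero.2 rfl] at hwt
    omega
  · have hne := mt wt_eq_zero.1 hc0
    have hA : Awt (rowSpan (genMat (circ genBits))) (wt c) ≠ 0 := Awt_ne_zero_iff.2 ⟨c, hc, rfl⟩
    have hdvd := heven c hc
    by_contra! hlt
    generalize wt c = w at *
    interval_cases w <;> omega
  · have hmem : ∀ i, genMat (circ genBits) i ∈ rowSpan (genMat (circ genBits)) :=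
      fun i => Submodule.subset_span ⟨i, rfl⟩
    have hdual := hmem 0
    rw [hself] at hdual
    have h01 := hdual _ (hmem 1)
    revert h01
    decide +kernel
end
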